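/- Let n ≥ 1 and let g : ℂ^{n+1} → ℂ be complex-analytic on an open neighborhood of 0, non-constant, with g(0) = 0. Then there exists ε₀ > 0 such that for every ε with 0 < ε ≤ ε₀, writing K_ε = g⁻¹(0) ∩ S_ε^{2n+1}, the map φ_ε(z) = g(z)/‖g(z)‖, from S_ε^{2n+1} \ K_ε to the unit circle S¹ ⊆ ℂ, is a locally trivial fibration. -/

import Mathlib

open Metric Topology Set

noncomputable section

/-- `q : X → Y` is a locally trivial fibration: there is a topological space `F` such that every
`y : Y` has an open neighborhood `W` and a homeomorphism `h : q⁻¹(W) ≃ₜ W × F` with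
`pr₁ ∘ h = q`. -/
def IsLocTrivialFibration {X Y : Type*} [TopologicalSpace X] [TopologicalSpace Y]
    (q : X → Y) : Prop :=
  ∃ (F : Type) (_ : TopologicalSpace F),
    ∀ y : Y, ∃ W : Set Y, IsOpen W ∧ y ∈ W ∧
      ∃ h : ↥(q ⁻¹' W) ≃ₜ ↥W × F, ∀ x : ↥(q ⁻¹' W), ((h x).1 : Y) = q x

section
open Metric Topology Set Filter

namespace Milnor

/-- membership in the (vector valued) disc algebra -/
def IsDisc {F : Type*} [NormedAddCommGroup F] [NormedSpace ℂ F] (ρ : ℝ)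
    (u : C(closedBall (0 : ℂ) ρ, F)) : Prop :=
  ∃ U : ℂ → F, DifferentiableOn ℂ U (ball 0 ρ) ∧ ∀ z : closedBall (0 : ℂ) ρ, u z = U z

theorem isDisc_closed {F : Type*} [NormedAddCommGroup F] [NormedSpace ℂ F] [CompleteSpace F]
    (ρ : ℝ) : IsClosed {u : C(closedBall (0 : ℂ) ρ, F) | IsDisc ρ u} := by
  apply IsSeqClosed.isClosed
  intro u u₀ hu hlim
  choose U hU hUu using hu
  classical
  refine ⟨fun z => if h : z ∈ closedBall (0 : ℂ) ρ then u₀ ⟨z, h⟩ else 0, ?_, ?_⟩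
  · have : TendstoLocallyUniformlyOn U
        (fun z => if h : z ∈ closedBall (0 : ℂ) ρ then u₀ ⟨z, h⟩ else 0) atTop (ball 0 ρ) := by
      apply TendstoUniformlyOn.tendstoLocallyUniformlyOn
      rw [Metric.tendstoUniformlyOn_iff]
      intro ε hε
      filter_upwards [(Metric.tendsto_nhds.1 hlim) ε hε] with n hn z hz
      have hz' : z ∈ closedBall (0 : ℂ) ρ := ball_subset_closedBall hz
      rw [dif_pos hz']
      have h1 := ContinuousMap.dist_apply_le_dist (f := u₀) (g := u n) ⟨z, hz'⟩
      rw [hUu n ⟨z, hz'⟩] at h1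
      rw [dist_comm] at hn
      exact h1.trans_lt hn
    exact this.differentiableOn (Eventually.of_forall hU) isOpen_ball
  · intro z
    simp only [Subtype.coe_eta, Subtype.coe_prop, dite_true]

/-- disc algebra, vector valued -/
def discMod (F : Type*) [NormedAddCommGroup F] [NormedSpace ℂ F] (ρ : ℝ) :
    Submodule ℂ C(closedBall (0 : ℂ) ρ, F) where
  carrier := {u | IsDisc ρ u}
  add_mem' := by
    rintro a b ⟨A, hA, hA'⟩ ⟨B, hB, hB'⟩
    exact ⟨A + B, hA.add hB, fun z => by simp [hA', hB']⟩
  zero_mem' := ⟨0, differentiableOn_const 0, fun z => by simp⟩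
  smul_mem' := by
    rintro c a ⟨A, hA, hA'⟩
    exact ⟨c • A, hA.const_smul c, fun z => by simp [hA']⟩

/-- disc algebra -/
def discAlg (ρ : ℝ) : Subalgebra ℂ C(closedBall (0 : ℂ) ρ, ℂ) where
  carrier := {u | IsDisc ρ u}
  add_mem' := by
    rintro a b ⟨A, hA, hA'⟩ ⟨B, hB, hB'⟩
    exact ⟨A + B, hA.add hB, fun z => by simp [hA', hB']⟩
  mul_mem' := by
    rintro a b ⟨A, hA, hA'⟩ ⟨B, hB, hB'⟩
    exact ⟨A * B, hA.mul hB, fun z => by simp [hA', hB']⟩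
  algebraMap_mem' := fun c => ⟨fun _ => c, differentiableOn_const c, fun z => rfl⟩

instance discAlg_complete (ρ : ℝ) : CompleteSpace (discAlg ρ) := by
  have : IsClosed ((discAlg ρ : Set C(closedBall (0 : ℂ) ρ, ℂ))) := isDisc_closed ρ
  exact this.completeSpace_coe

/-- evaluation as a continuous linear map -/
def discEval (ρ : ℝ) (z : closedBall (0 : ℂ) ρ) : discAlg ρ →L[ℂ] ℂ :=
  (ContinuousMap.evalCLM ℂ z).comp (discAlg ρ).toSubmodule.subtypeL

@[simp] theorem discEval_apply (ρ : ℝ) (z : closedBall (0 : ℂ) ρ) (b : discAlg ρ) :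
    discEval ρ z b = b.1 z := rfl

/-- multilinear substitution: `p ∘ (u₁, …, uₙ)`. -/
def discMulti {V : Type*} [NormedAddCommGroup V] [NormedSpace ℂ V] (ρ : ℝ) {n : ℕ}
    (p : ContinuousMultilinearMap ℂ (fun _ : Fin n => V) ℂ) :
    ContinuousMultilinearMap ℂ (fun _ : Fin n => discMod V ρ) (discAlg ρ) :=
  MultilinearMap.mkContinuous
    { toFun := fun u => ⟨⟨fun z => p (fun i => (u i).1 z), by fun_prop⟩, by
        have := fun i => (u i).2
        choose U hU hU' using this
        refine ⟨fun z => p (fun i => U i z), ?_, fun z => ?_⟩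
        · intro z hz
          have hp : DifferentiableAt ℂ p (fun i => U i z) := (p.hasFDerivAt _).differentiableAt
          have : DifferentiableWithinAt ℂ (fun z i => U i z) (ball 0 ρ) z :=
            differentiableWithinAt_pi.2 fun i => hU i z hz
          exact hp.comp_differentiableWithinAt z this
        · change p _ = p _
          congr 1
          funext i
          exact hU' i z⟩
      map_update_add' := by
        intro _ m i x y
        apply Subtype.ext
        ext z
        have key : ∀ w : discMod V ρ, (fun j => (Function.update m i w j).1 z) =
            Function.update (fun j => (m j).1 z) i (w.1 z) := by
          intro w
          funext j
          by_cases h : j = i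
          · subst h; simp
          · simp [h]
        change p _ = p _ + p _
        rw [key, key, key]
        exact p.map_update_add _ _ _ _
      map_update_smul' := by
        intro _ m i c x
        apply Subtype.ext
        ext z
        have key : ∀ w : discMod V ρ, (fun j => (Function.update m i w j).1 z) =
            Function.update (fun j => (m j).1 z) i (w.1 z) := by
          intro w
          funext j
          by_cases h : j = i
          · subst h; simp
          · simp [h]
        change p _ = c • p _
        rw [key, key]
        exact p.map_update_smul _ _ _ _ }
    ‖p‖ (by
      intro u
      change ‖(⟨fun z => p (fun i => (u i).1 z), _⟩ : C(closedBall (0 : ℂ) ρ, ℂ))‖ ≤ _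
      rw [ContinuousMap.norm_le _ (by positivity)]
      intro z
      refine (p.le_opNorm _).trans ?_
      gcongr with i
      exact ContinuousMap.norm_coe_le_norm (u i).1 z)

@[simp] theorem discMulti_apply {V : Type*} [NormedAddCommGroup V] [NormedSpace ℂ V] (ρ : ℝ) {n : ℕ}
    (p : ContinuousMultilinearMap ℂ (fun _ : Fin n => V) ℂ) (u : Fin n → discMod V ρ)
    (z : closedBall (0 : ℂ) ρ) : (discMulti ρ p u).1 z = p (fun i => (u i).1 z) := rfl

theorem norm_discMulti_le {V : Type*} [NormedAddCommGroup V] [NormedSpace ℂ V] (ρ : ℝ) {n : ℕ}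
    (p : ContinuousMultilinearMap ℂ (fun _ : Fin n => V) ℂ) : ‖discMulti ρ p‖ ≤ ‖p‖ :=
  MultilinearMap.mkContinuous_norm_le _ (norm_nonneg _) _

/-- the affine line -/
def discLine {V : Type*} [NormedAddCommGroup V] [NormedSpace ℂ V] (ρ : ℝ) (v x : V) :
    discMod V ρ :=
  ⟨⟨fun z => x + (z : ℂ) • v, by fun_prop⟩, fun z => x + z • v, by fun_prop, fun z => rfl⟩

theorem discLine_analytic {V : Type*} [NormedAddCommGroup V] [NormedSpace ℂ V] (ρ : ℝ)
    (v : V) (W : Submodule ℂ V) (x₀ : W) :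
    AnalyticAt ℂ (fun x : W => discLine ρ v (x : V)) x₀ := by
  let L : W →L[ℂ] discMod V ρ := LinearMap.mkContinuous
    { toFun := fun x => ⟨⟨fun z => (x : V), by fun_prop⟩, fun z => x, by fun_prop, fun z => rfl⟩
      map_add' := fun x y => rfl
      map_smul' := fun c x => rfl } 1 (by
        intro x
        change ‖(⟨fun z => (x : V), _⟩ : C(closedBall (0 : ℂ) ρ, V))‖ ≤ _
        rw [ContinuousMap.norm_le _ (by positivity)]
        intro z
        simp)
  have h : (fun x : W => discLine ρ v (x : V)) = fun x => L x + discLine ρ v 0 := by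
    funext x
    apply Subtype.ext
    ext z
    change (x : V) + (z : ℂ) • v = (x : V) + (0 + (z : ℂ) • v)
    rw [zero_add]
  rw [h]
  exact (L.analyticAt x₀).add analyticAt_const

/-- Substituting lines in an analytic function gives an analytic map into the disc algebra. -/
theorem disc_analytic {V : Type*} [NormedAddCommGroup V] [NormedSpace ℂ V] (W : Submodule ℂ V)
    (v : V) (f : V → ℂ) (hf : AnalyticAt ℂ f 0) :
    ∃ r > 0, ∀ ρ, 0 < ρ → ρ < r → ∃ F : W → discAlg ρ, AnalyticAt ℂ F 0 ∧
      ∀ᶠ x in 𝓝 (0 : W), ∀ z : closedBall (0 : ℂ) ρ, (F x).1 z = f ((x : V) + (z : ℂ) • v) := by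
  obtain ⟨p, R, hp⟩ := hf
  obtain ⟨R', hR'0, hR'⟩ := ENNReal.lt_iff_exists_nnreal_btwn.1 hp.r_pos
  have hR'pos : (0 : ℝ) < R' := by exact_mod_cast hR'0
  refine ⟨R' / (‖v‖ + 1), by positivity, fun ρ hρ hρr => ?_⟩
  let q : FormalMultilinearSeries ℂ (discMod V ρ) (discAlg ρ) := fun n => discMulti ρ (p n)
  have hq : p.radius ≤ q.radius :=
    FormalMultilinearSeries.radius_le_of_le fun n => norm_discMulti_le ρ (p n)
  have hqR : (R' : ENNReal) < q.radius := hR'.trans_le (hp.r_le.trans hq)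
  have hqs := q.hasFPowerSeriesOnBall (hR'0.trans hqR)
  have hρv : ρ * ‖v‖ < R' := by
    rw [lt_div_iff₀ (by positivity)] at hρr
    nlinarith [norm_nonneg v]
  have hline : ∀ x : V, ‖x‖ + ρ * ‖v‖ < R' → ‖discLine ρ v x‖ < R' := by
    intro x hx
    refine lt_of_le_of_lt ?_ hx
    change ‖(discLine ρ v x).1‖ ≤ _
    rw [ContinuousMap.norm_le _ (by positivity)]
    intro z
    change ‖x + (z : ℂ) • v‖ ≤ _
    refine (norm_add_le _ _).trans ?_
    rw [norm_smul]
    gcongr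
    exact mem_closedBall_zero_iff.1 z.2
  have hmem : ∀ x : V, ‖x‖ + ρ * ‖v‖ < R' → discLine ρ v x ∈ Metric.eball 0 q.radius := by
    intro x hx
    rw [Metric.mem_eball, edist_zero_right]
    refine lt_of_lt_of_le ?_ hqR.le
    have := hline x hx
    rw [← ofReal_norm, ENNReal.ofReal_lt_iff_lt_toReal (norm_nonneg _) (by simp)]
    simpa using this
  refine ⟨fun x => q.sum (discLine ρ v (x : V)), ?_, ?_⟩
  · have h1 := hqs.analyticAt_of_mem (hmem 0 (by simpa using hρv))
    exact AnalyticAt.comp (g := q.sum) (f := fun x : W => discLine ρ v (x : V)) (x := 0)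
      (by simpa using h1) (discLine_analytic ρ v W 0)
  · have : ∀ᶠ x : W in 𝓝 (0 : W), ‖(x : V)‖ + ρ * ‖v‖ < R' := by
      have hc : ContinuousAt (fun x : W => ‖(x : V)‖ + ρ * ‖v‖) 0 := by fun_prop
      exact hc.eventually_lt continuousAt_const (by simpa using hρv)
    filter_upwards [this] with x hx z
    have hs := q.hasSum (hmem x hx)
    have hs2 := (discEval ρ z).hasSum hs
    have hs3 : HasSum (fun n => p n fun _ => (x : V) + (z : ℂ) • v) (f (0 + ((x : V) + (z : ℂ) • v))) := by
      apply hp.hasSum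
      rw [Metric.mem_eball, edist_zero_right]
      refine lt_of_le_of_lt ?_ hR'
      rw [← ofReal_norm]
      have : ‖(x : V) + (z : ℂ) • v‖ ≤ R' := by
        refine le_trans ?_ (hline x hx).le
        exact ContinuousMap.norm_coe_le_norm (discLine ρ v (x : V)).1 z
      rw [ENNReal.ofReal_le_iff_le_toReal (by simp)]
      simpa using this
    rw [zero_add] at hs3
    exact hs2.unique hs3

end Milnor
end

section
open Metric Topology Set Filter

namespace Milnor

/-- the coordinate function -/
def discZ (ρ : ℝ) : discAlg ρ :=
  ⟨⟨fun z => (z : ℂ), by fun_prop⟩, fun z => z, differentiableOn_id, fun z => rfl⟩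

@[simp] theorem discZ_apply (ρ : ℝ) (z : closedBall (0 : ℂ) ρ) : (discZ ρ).1 z = z := rfl

/-- constants -/
abbrev discC (ρ : ℝ) (c : ℂ) : discAlg ρ := algebraMap ℂ (discAlg ρ) c

theorem discC_apply (ρ : ℝ) (c : ℂ) (z : closedBall (0 : ℂ) ρ) : (discC ρ c).1 z = c := rfl

theorem disc_shift {ρ : ℝ} (hρ : 0 < ρ) (b : discAlg ρ) :
    ∃ (c : ℂ) (b' : discAlg ρ), b = discC ρ c + discZ ρ * b' := by
  obtain ⟨U, hU, hbU⟩ := b.2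
  have h0 : (0 : ℂ) ∈ ball (0 : ℂ) ρ := mem_ball_self hρ
  have hd : DifferentiableOn ℂ (dslope U 0) (ball 0 ρ) :=
    (Complex.differentiableOn_dslope (isOpen_ball.mem_nhds h0)).2 hU
  have hcont : Continuous fun z : closedBall (0 : ℂ) ρ => dslope U 0 z := by
    rw [continuous_iff_continuousAt]
    intro z
    by_cases hz : (z : ℂ) = 0
    · have h1 : ContinuousAt (dslope U 0) (z : ℂ) := by
        rw [hz]
        exact (hd.differentiableAt (isOpen_ball.mem_nhds h0)).continuousAt
      exact h1.comp continuous_subtype_val.continuousAt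
    · have h2 : (fun z : closedBall (0 : ℂ) ρ => dslope U 0 z) =ᶠ[𝓝 z]
          fun z => (z : ℂ)⁻¹ * (b.1 z - U 0) := by
        have : ∀ᶠ w : closedBall (0 : ℂ) ρ in 𝓝 z, (w : ℂ) ≠ 0 :=
          continuous_subtype_val.continuousAt.eventually_ne hz
        filter_upwards [this] with w hw
        rw [dslope_of_ne _ hw, slope_def_field, hbU w]
        field_simp
        ring
      refine ContinuousAt.congr ?_ h2.symm
      have h3 : ContinuousAt (fun z : closedBall (0 : ℂ) ρ => (z : ℂ)⁻¹) z :=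
        (continuous_subtype_val.continuousAt).inv₀ hz
      exact h3.mul ((b.1.continuous.continuousAt).sub continuousAt_const)
  refine ⟨U 0, ⟨⟨_, hcont⟩, dslope U 0, hd, fun z => rfl⟩, ?_⟩
  apply Subtype.ext
  ext z
  change b.1 z = U 0 + (z : ℂ) * dslope U 0 z
  rw [hbU]
  have := sub_smul_dslope U 0 (z : ℂ)
  simp only [sub_zero, smul_eq_mul] at this
  rw [this]
  ring

theorem disc_div_pow {ρ : ℝ} (hρ : 0 < ρ) (n : ℕ) (b : discAlg ρ) :
    ∃ (r : Fin n → ℂ) (b' : discAlg ρ),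
      b = discZ ρ ^ n * b' + ∑ i, r i • discZ ρ ^ (i : ℕ) := by
  induction n generalizing b with
  | zero => exact ⟨Fin.elim0, b, by simp⟩
  | succ n ih =>
    obtain ⟨c, b1, hb1⟩ := disc_shift hρ b
    obtain ⟨r, b', hb'⟩ := ih b1
    refine ⟨Fin.cons c r, b', ?_⟩
    rw [Fin.sum_univ_succ]
    simp only [Fin.val_zero, pow_zero, Fin.cons_zero, Fin.val_succ, Fin.cons_succ]
    rw [hb1, discC, Algebra.algebraMap_eq_smul_one]
    conv_lhs => rw [hb']
    rw [mul_add, Finset.mul_sum]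
    have : ∀ i : Fin n, discZ ρ * r i • discZ ρ ^ (i : ℕ) = r i • discZ ρ ^ ((i : ℕ) + 1) := by
      intro i
      rw [mul_smul_comm, pow_succ']
    simp only [this]
    ring

theorem discZ_mul_eq_zero {ρ : ℝ} (hρ : 0 < ρ) (b : discAlg ρ) (h : discZ ρ * b = 0) : b = 0 := by
  have h1 : ∀ z : closedBall (0 : ℂ) ρ, (z : ℂ) ≠ 0 → b.1 z = 0 := by
    intro z hz
    have := congrArg (fun u : discAlg ρ => u.1 z) h
    change (z : ℂ) * b.1 z = 0 at this
    exact (mul_eq_zero.1 this).resolve_left hz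
  obtain ⟨U, hU, hbU⟩ := b.2
  apply Subtype.ext
  ext z
  change b.1 z = 0
  by_cases hz : (z : ℂ) = 0
  · rw [hbU, hz]
    have hc : ContinuousAt U 0 :=
      (hU.differentiableAt (isOpen_ball.mem_nhds (mem_ball_self hρ))).continuousAt
    have h2 : Tendsto U (𝓝[≠] 0) (𝓝 (U 0)) := hc.tendsto.mono_left nhdsWithin_le_nhds
    have h3 : Tendsto U (𝓝[≠] 0) (𝓝 0) := by
      apply tendsto_const_nhds.congr'
      have : ball (0 : ℂ) ρ ∈ 𝓝[≠] 0 := nhdsWithin_le_nhds (ball_mem_nhds _ hρ)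
      filter_upwards [this, self_mem_nhdsWithin] with w hw hw0
      exact ((hbU ⟨w, ball_subset_closedBall hw⟩).symm.trans
        (h1 ⟨w, ball_subset_closedBall hw⟩ hw0)).symm
    exact tendsto_nhds_unique h2 h3
  · exact h1 z hz

theorem disc_div_unique {ρ : ℝ} (hρ : 0 < ρ) (n : ℕ) (r : Fin n → ℂ) (b : discAlg ρ)
    (h : discZ ρ ^ n * b + ∑ i, r i • discZ ρ ^ (i : ℕ) = 0) : b = 0 ∧ r = 0 := by
  induction n with
  | zero => exact ⟨by simpa using h, Subsingleton.elim _ _⟩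
  | succ n ih =>
    have hr0 : r 0 = 0 := by
      have := congrArg (fun u : discAlg ρ => discEval ρ ⟨0, mem_closedBall_self hρ.le⟩ u) h
      simp only [map_add, map_sum, map_smul, Fin.sum_univ_succ] at this
      simpa using this
    have h2 : discZ ρ * (discZ ρ ^ n * b + ∑ i : Fin n, r i.succ • discZ ρ ^ (i : ℕ)) = 0 := by
      rw [← h, Fin.sum_univ_succ, hr0, mul_add, Finset.mul_sum]
      have : ∀ i : Fin n, discZ ρ * r i.succ • discZ ρ ^ (i : ℕ)
          = r i.succ • discZ ρ ^ ((i : ℕ) + 1) := by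
        intro i
        rw [mul_smul_comm, pow_succ']
      simp only [this, Fin.val_succ, zero_smul, zero_add]
      ring
    obtain ⟨h3, h4⟩ := ih _ (discZ_mul_eq_zero hρ _ h2)
    refine ⟨h3, ?_⟩
    funext i
    refine Fin.cases hr0 (fun j => ?_) i
    exact congrFun h4 j

theorem abs_linear_solve {X B P : Type*} [NormedAddCommGroup X] [NormedSpace ℂ X]
    [NormedAddCommGroup B] [NormedSpace ℂ B] [CompleteSpace B]
    [NormedAddCommGroup P] [NormedSpace ℂ P] [CompleteSpace P]
    (Φ : X → (P →L[ℂ] B)) (hΦ : AnalyticAt ℂ Φ 0) (hbij : Function.Bijective (Φ 0))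
    (H : X → B) (hH : AnalyticAt ℂ H 0) :
    ∃ R : X → P, AnalyticAt ℂ R 0 ∧ ∀ᶠ x in 𝓝 0, Φ x (R x) = H x := by
  let e : P ≃L[ℂ] B := ContinuousLinearEquiv.ofBijective (Φ 0)
      (LinearMap.ker_eq_bot.2 hbij.1) (LinearMap.range_eq_top.2 hbij.2)
  have he : ∀ p, e p = Φ 0 p := fun p => rfl
  let G : X → (P →L[ℂ] P) := fun x => (e.symm : B →L[ℂ] P).comp (Φ x)
  have hGa : AnalyticAt ℂ G 0 :=
    (((ContinuousLinearMap.compL ℂ P B P) (e.symm : B →L[ℂ] P)).analyticAt _).comp hΦ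
  have hG0 : G 0 = 1 := by
    apply ContinuousLinearMap.ext
    intro p
    change e.symm (Φ 0 p) = p
    rw [← he, e.symm_apply_apply]
  have hinv : AnalyticAt ℂ (fun x => Ring.inverse (G x)) 0 := by
    have h1 : AnalyticAt ℂ Ring.inverse (G 0) := by
      rw [hG0]
      exact analyticAt_inverse (𝕜 := ℂ) (A := P →L[ℂ] P) 1
    exact AnalyticAt.comp (g := Ring.inverse) h1 hGa
  have hunit : ∀ᶠ x in 𝓝 (0 : X), IsUnit (G x) := by
    have : {x : P →L[ℂ] P | IsUnit x} ∈ 𝓝 (G 0) :=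
      Units.isOpen.mem_nhds (by change IsUnit (G 0); rw [hG0]; exact isUnit_one)
    exact hGa.continuousAt.eventually this
  refine ⟨fun x => Ring.inverse (G x) (e.symm (H x)), ?_, ?_⟩
  · have h2 : AnalyticAt ℂ (fun x => e.symm (H x)) 0 :=
      ((e.symm : B →L[ℂ] P).analyticAt _).comp hH
    have h3 := (ContinuousLinearMap.id ℂ (P →L[ℂ] P)).analyticAt_bilinear
      (Ring.inverse (G 0), e.symm (H 0))
    exact AnalyticAt.comp (f := fun x => (Ring.inverse (G x), e.symm (H x))) h3 (hinv.prod h2)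
  · filter_upwards [hunit] with x hx
    have h1 : (G x) * Ring.inverse (G x) = 1 := Ring.mul_inverse_cancel _ hx
    have h2 : G x (Ring.inverse (G x) (e.symm (H x))) = e.symm (H x) := by
      change (G x * Ring.inverse (G x)) (e.symm (H x)) = _
      rw [h1]; rfl
    exact e.symm.injective h2

theorem clm_comp_an {X E G : Type*} [NormedAddCommGroup X] [NormedSpace ℂ X]
    [NormedAddCommGroup E] [NormedSpace ℂ E] [NormedAddCommGroup G] [NormedSpace ℂ G]
    (L : E →L[ℂ] G) (F : X → E) (hF : AnalyticAt ℂ F 0) : AnalyticAt ℂ (fun x => L (F x)) 0 :=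
  (L.analyticAt _).comp hF

theorem abs_div {X A Q : Type*} [NormedAddCommGroup X] [NormedSpace ℂ X]
    [NormedCommRing A] [NormedAlgebra ℂ A] [CompleteSpace A]
    [NormedAddCommGroup Q] [NormedSpace ℂ Q] [CompleteSpace Q]
    (C : Q →L[ℂ] A) (F H : X → A) (hF : AnalyticAt ℂ F 0) (hH : AnalyticAt ℂ H 0)
    (hbij : Function.Bijective (fun p : A × Q => F 0 * p.1 + C p.2)) :
    ∃ (q : X → A) (r : X → Q), AnalyticAt ℂ r 0 ∧ ∀ᶠ x in 𝓝 0, F x * q x + C (r x) = H x := by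
  let L : A →L[ℂ] (A × Q) →L[ℂ] A :=
    ((ContinuousLinearMap.compL ℂ (A × Q) A A).flip (ContinuousLinearMap.fst ℂ A Q)).comp
      (ContinuousLinearMap.mul ℂ A)
  let Φ : X → (A × Q) →L[ℂ] A := fun x => L (F x) + C.comp (ContinuousLinearMap.snd ℂ A Q)
  have hΦ : AnalyticAt ℂ Φ 0 := by
    have h1 : AnalyticAt ℂ (fun x => L (F x)) 0 :=
      clm_comp_an (G := (A × Q) →L[ℂ] A) L F hF
    have h2 : AnalyticAt ℂ (fun _ : X => C.comp (ContinuousLinearMap.snd ℂ A Q)) 0 :=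
      analyticAt_const
    exact AnalyticAt.add h1 h2
  have hval : ∀ x p, Φ x p = F x * p.1 + C p.2 := fun x p => by
    simp [Φ, L]
  have hbij' : Function.Bijective (Φ 0) := by
    rw [show (⇑(Φ 0) : A × Q → A) = fun p => F 0 * p.1 + C p.2 from funext (hval 0)]
    exact hbij
  obtain ⟨R, hR, hR2⟩ := abs_linear_solve Φ hΦ hbij' H hH
  refine ⟨fun x => (R x).1, fun x => (R x).2,
    ((ContinuousLinearMap.snd ℂ A Q).analyticAt _).comp hR, ?_⟩
  filter_upwards [hR2] with x hx
  rw [← hx, hval]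

/-- The constant part of the division operator `(q, r) ↦ q f + ∑ rᵢ zⁱ`. -/
def divOpC (ρ : ℝ) (n : ℕ) : (Fin n → ℂ) →L[ℂ] discAlg ρ :=
  ∑ i : Fin n, ((ContinuousLinearMap.proj i : (Fin n → ℂ) →L[ℂ] ℂ).smulRight (discZ ρ ^ (i : ℕ)))

theorem divOpC_apply (ρ : ℝ) (n : ℕ) (p) : divOpC ρ n p = ∑ i, p i • discZ ρ ^ (i : ℕ) := by
  simp [divOpC]

theorem divOp_bij {ρ : ℝ} (hρ : 0 < ρ) (n : ℕ) (f u v : discAlg ρ) (huv : u * v = 1)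
    (hf : f = discZ ρ ^ n * u) : Function.Bijective
      (fun p : discAlg ρ × (Fin n → ℂ) => f * p.1 + divOpC ρ n p.2) := by
  constructor
  · have : ∀ p : discAlg ρ × (Fin n → ℂ), f * p.1 + divOpC ρ n p.2 = 0 → p = 0 := by
      rintro ⟨q, r⟩ h
      rw [divOpC_apply, hf, mul_assoc] at h
      obtain ⟨h1, h2⟩ := disc_div_unique hρ n r (u * q) h
      have : q = 0 := by
        calc q = v * (u * q) := by rw [← mul_assoc, mul_comm v, huv, one_mul]
          _ = 0 := by rw [h1, mul_zero]
      rw [this, h2]; rfl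
    intro p p' h
    rw [← sub_eq_zero]
    apply this
    have h' : f * p.1 + divOpC ρ n p.2 = f * p'.1 + divOpC ρ n p'.2 := h
    rw [Prod.fst_sub, Prod.snd_sub, map_sub, mul_sub, ← sub_eq_zero.2 h']
    ring
  · intro b
    obtain ⟨r, b', hb⟩ := disc_div_pow hρ n b
    refine ⟨(v * b', r), ?_⟩
    change f * (v * b') + divOpC ρ n r = b
    rw [divOpC_apply, hf]
    conv_rhs => rw [hb]
    congr 1
    calc discZ ρ ^ n * u * (v * b') = discZ ρ ^ n * (u * v) * b' := by ring
      _ = _ := by rw [huv, mul_one]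

theorem weierstrass_finite {V : Type*} [NormedAddCommGroup V] [NormedSpace ℂ V]
    (τ : V →L[ℂ] ℂ) (v : V) (f : V → ℂ) (hf : AnalyticAt ℂ f 0)
    (hfv : ¬ ∀ᶠ t : ℂ in 𝓝 0, f (t • v) = 0)
    (π : V → LinearMap.ker τ.toLinearMap) (hπ : Continuous π) (hπ0 : π 0 = 0)
    (hπv : ∀ x, (π x : V) + τ x • v = x) :
    ∃ n : ℕ, ∀ h : V → ℂ, AnalyticAt ℂ h 0 →
      ∃ r : Fin n → (LinearMap.ker τ.toLinearMap → ℂ), (∀ i, AnalyticAt ℂ (r i) 0) ∧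
        ∀ᶠ x in 𝓝 (0 : V), f x = 0 → h x = ∑ i, r i (π x) * τ x ^ (i : ℕ) := by
  have hg0 : AnalyticAt ℂ (fun t : ℂ => f (t • v)) 0 := by
    have : AnalyticAt ℂ (fun t : ℂ => t • v) 0 := by fun_prop
    refine AnalyticAt.fun_comp ?_ this
    simpa using hf
  obtain ⟨n, u, hu, hu0, hfu⟩ := hg0.exists_eventuallyEq_pow_smul_nonzero_iff.2 hfv
  refine ⟨n, fun h hh => ?_⟩
  have hev : ∀ᶠ t : ℂ in 𝓝 0, AnalyticAt ℂ u t ∧ u t ≠ 0 ∧ f (t • v) = t ^ n * u t := by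
    filter_upwards [hu.eventually_analyticAt, hu.continuousAt.eventually_ne hu0, hfu] with t h1 h2 h3
    refine ⟨h1, h2, ?_⟩
    simpa using h3
  obtain ⟨r3, hr3, hball⟩ := Metric.eventually_nhds_iff_ball.1 hev
  obtain ⟨r1, hr1, hF⟩ := disc_analytic (LinearMap.ker τ.toLinearMap) v f hf
  obtain ⟨r2, hr2, hH⟩ := disc_analytic (LinearMap.ker τ.toLinearMap) v h hh
  obtain ⟨ρ, hρ, hρ'⟩ := exists_between (lt_min hr3 (lt_min hr1 hr2))
  have hρ3 : ρ < r3 := lt_of_lt_of_le hρ' (min_le_left _ _)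
  have hρ1 : ρ < r1 := lt_of_lt_of_le hρ' ((min_le_right _ _).trans (min_le_left _ _))
  have hρ2 : ρ < r2 := lt_of_lt_of_le hρ' ((min_le_right _ _).trans (min_le_right _ _))
  obtain ⟨F, hFa, hFe⟩ := hF ρ hρ hρ1
  obtain ⟨H, hHa, hHe⟩ := hH ρ hρ hρ2
  have hgood : ∀ z : closedBall (0 : ℂ) ρ, AnalyticAt ℂ u z ∧ u z ≠ 0 ∧
      f ((z : ℂ) • v) = (z : ℂ) ^ n * u z := fun z =>
    hball z (closedBall_subset_ball hρ3 z.2)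
  let uB : discAlg ρ := ⟨⟨fun z => u z, by
    rw [continuous_iff_continuousAt]
    intro z
    exact (hgood z).1.continuousAt.comp continuous_subtype_val.continuousAt⟩, u, fun z hz =>
      (hgood ⟨z, ball_subset_closedBall hz⟩).1.differentiableAt.differentiableWithinAt,
      fun z => rfl⟩
  let iB : discAlg ρ := ⟨⟨fun z => (u z)⁻¹, by
    rw [continuous_iff_continuousAt]
    intro z
    exact ((hgood z).1.continuousAt.comp continuous_subtype_val.continuousAt).inv₀ (hgood z).2.1⟩,
      fun z => (u z)⁻¹, fun z hz =>
      ((hgood ⟨z, ball_subset_closedBall hz⟩).1.differentiableAt.inv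
        (hgood ⟨z, ball_subset_closedBall hz⟩).2.1).differentiableWithinAt,
      fun z => rfl⟩
  have huB : uB * iB = 1 := by
    apply Subtype.ext
    ext z
    change u z * (u z)⁻¹ = 1
    exact mul_inv_cancel₀ (hgood z).2.1
  have hF0 : F 0 = discZ ρ ^ n * uB := by
    apply Subtype.ext
    ext z
    have := hFe.self_of_nhds z
    rw [this]
    change _ = (z : ℂ) ^ n * u z
    simpa using (hgood z).2.2
  have hbij := divOp_bij hρ n (F 0) uB iB huB hF0
  obtain ⟨q, r, hra, hqr⟩ := abs_div (divOpC ρ n) F H hFa hHa hbij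
  refine ⟨fun i x => r x i, fun i => ?_, ?_⟩
  · exact ((ContinuousLinearMap.proj i : (Fin n → ℂ) →L[ℂ] ℂ).analyticAt _).comp hra
  · have hπt : Tendsto π (𝓝 0) (𝓝 0) := by
      simpa [hπ0] using hπ.tendsto 0
    have hτ : ∀ᶠ x in 𝓝 (0 : V), τ x ∈ closedBall (0 : ℂ) ρ := by
      have : Tendsto τ (𝓝 0) (𝓝 0) := by simpa using τ.continuous.tendsto 0
      exact this.eventually (closedBall_mem_nhds _ hρ)
    filter_upwards [hπt.eventually hqr, hπt.eventually hFe, hπt.eventually hHe, hτ]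
      with x h1 h2 h3 h4 h5
    rw [divOpC_apply] at h1
    have h6 := congrArg (fun b : discAlg ρ => discEval ρ ⟨τ x, h4⟩ b) h1
    simp only [map_add, map_sum, map_smul] at h6
    simp only [discEval_apply] at h6
    rw [h3 ⟨τ x, h4⟩] at h6
    change (F (π x)).1 ⟨τ x, h4⟩ * (q (π x)).1 ⟨τ x, h4⟩ + ∑ i, r (π x) i * (τ x) ^ (i : ℕ) = _ at h6
    rw [h2 ⟨τ x, h4⟩] at h6
    simp only [hπv, h5, zero_mul, zero_add] at h6
    exact h6.symm

end Milnor
end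

section
open Polynomial

namespace Milnor

/-- Hahn series over `ℚ` with complex coefficients. -/
abbrev HH := HahnSeries ℚ ℂ

/-- formal power series `ℂ⟦t⟧` -/
abbrev PS := PowerSeries ℂ

/-- the inclusion of power series -/
abbrev iotaH : PS →+* HH := HahnSeries.ofPowerSeries ℚ ℂ

theorem ps_adic : IsAdicComplete (IsLocalRing.maximalIdeal PS) PS := by
  rw [PowerSeries.maximalIdeal_eq_span_X]
  infer_instance

theorem ps_mem_max (f : PS) : f ∈ IsLocalRing.maximalIdeal PS ↔ PowerSeries.constantCoeff f = 0 := by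
  rw [PowerSeries.maximalIdeal_eq_span_X, Ideal.mem_span_singleton, PowerSeries.X_dvd_iff]

theorem factor_lemma (n : ℕ) (G : PS[X]) (hG : G.Monic) (hn : G.natDegree = n)
    (h0 : PowerSeries.constantCoeff (G.coeff 0) = 0)
    (hne : ∃ i < n, PowerSeries.constantCoeff (G.coeff i) ≠ 0) :
    ∃ P Q : PS[X], P.Monic ∧ Q.Monic ∧ P.natDegree < n ∧ Q.natDegree < n ∧ G = P * Q := by
  have := ps_adic
  obtain ⟨i, hi, hgi⟩ := hne
  have hmap : (G : PowerSeries PS).map (IsLocalRing.residue PS) ≠ 0 := by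
    intro h
    have := congrArg (PowerSeries.coeff i) h
    rw [PowerSeries.coeff_map, Polynomial.coeff_coe, map_zero, IsLocalRing.residue_eq_zero_iff,
      ps_mem_max] at this
    exact hgi this
  obtain ⟨P, u, hP⟩ := PowerSeries.exists_isWeierstrassFactorization hmap
  have hPm : P.Monic := hP.isDistinguishedAt.monic
  have hPc : ∀ j < P.natDegree, PowerSeries.constantCoeff (P.coeff j) = 0 := fun j hj =>
    (ps_mem_max _).1 (hP.isDistinguishedAt.mem hj)
  have hpos : 0 < P.natDegree := by
    rcases Nat.eq_zero_or_pos P.natDegree with h | h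
    · exfalso
      have hP1 : P = 1 := hPm.natDegree_eq_zero.1 h
      have h1 := hP.eq_mul
      rw [hP1] at h1
      simp only [Polynomial.coe_one, one_mul] at h1
      have h2 := hP.isUnit
      rw [← h1, PowerSeries.isUnit_iff_constantCoeff] at h2
      rw [← PowerSeries.coeff_zero_eq_constantCoeff_apply, Polynomial.coeff_coe,
        PowerSeries.isUnit_iff_constantCoeff, h0] at h2
      exact not_isUnit_zero h2
    · exact h
  have hle : P.natDegree ≤ i := by
    by_contra hlt
    push Not at hlt
    apply hgi
    rw [← Polynomial.coeff_coe, hP.eq_mul, PowerSeries.coeff_mul, map_sum]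
    apply Finset.sum_eq_zero
    intro x hx
    rw [map_mul, Polynomial.coeff_coe, hPc, zero_mul]
    have := Finset.HasAntidiagonal.mem_antidiagonal.1 hx
    omega
  have hdiv := Polynomial.modByMonic_add_div G P
  have hps : ((P : PS[X]) : PowerSeries PS) * u + ((0 : PS[X]) : PowerSeries PS) =
      (P : PowerSeries PS) * ((G /ₘ P : PS[X]) : PowerSeries PS) + ((G %ₘ P : PS[X]) : PowerSeries PS) := by
    rw [← hP.eq_mul]
    conv_lhs => rw [← hdiv]
    push_cast
    ring
  have hord : ((P : PowerSeries PS).map (Ideal.Quotient.mk (IsLocalRing.maximalIdeal PS))).order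
      = P.natDegree := by
    rw [PowerSeries.order_eq_nat]
    constructor
    · rw [PowerSeries.coeff_map, Polynomial.coeff_coe, hPm.coeff_natDegree, map_one]
      exact one_ne_zero
    · intro j hj
      rw [PowerSeries.coeff_map, Polynomial.coeff_coe, Ideal.Quotient.eq_zero_iff_mem]
      exact hP.isDistinguishedAt.mem hj
  have hD := hP.isDistinguishedAt.isWeierstrassDivisorAt (Ideal.IsPrime.ne_top inferInstance)
  obtain ⟨h1, h2⟩ := hD.eq_of_mul_add_eq_mul_add (by rw [hord]; simp) (by
    rw [hord, ENat.toNat_natCast]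
    calc (G %ₘ P).degree < P.degree := degree_modByMonic_lt _ hPm
      _ = _ := degree_eq_natDegree hPm.ne_zero) hps
  rw [← h2, zero_add] at hdiv
  have hQm : (G /ₘ P).Monic := by
    apply hPm.of_mul_monic_left
    rw [hdiv]; exact hG
  have hdeg : P.natDegree + (G /ₘ P).natDegree = n := by
    rw [← hPm.natDegree_mul hQm, hdiv, hn]
  exact ⟨P, G /ₘ P, hPm, hQm, by omega, by omega, hdiv.symm⟩

/-- substitution `t ↦ t^{1/k}` on Hahn series -/
def rootH (k : ℕ) (hk : k ≠ 0) : HH →+* HH :=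
  HahnSeries.embDomainRingHom
    (AddMonoidHom.mulRight ((k : ℚ)⁻¹)) (fun a b h => by
      have hk' : (k : ℚ)⁻¹ ≠ 0 := by positivity
      exact mul_right_cancel₀ hk' h)
    (fun a b => by
      have hk' : 0 < (k : ℚ)⁻¹ := by positivity
      exact mul_le_mul_iff_of_pos_right hk')

theorem rootH_coeff (k : ℕ) (hk : k ≠ 0) (x : HH) (q : ℚ) :
    (rootH k hk x).coeff q = x.coeff (k * q) := by
  have hk' : (k : ℚ) ≠ 0 := by positivity
  have : q = (k * q) * (k : ℚ)⁻¹ := by field_simp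
  conv_lhs => rw [this]
  exact HahnSeries.embDomain_coeff

theorem iotaH_coeff_of_not (f : PS) (q : ℚ) (hq : ∀ m : ℕ, (m : ℚ) ≠ q) : (iotaH f).coeff q = 0 := by
  rw [iotaH, HahnSeries.ofPowerSeries_apply]
  apply HahnSeries.embDomain_of_notMem_range
  rintro ⟨m, hm⟩
  exact hq m hm

theorem rootH_iotaH (k : ℕ) (hk : k ≠ 0) (f : PS) :
    rootH k hk (iotaH (PowerSeries.expand k hk f)) = iotaH f := by
  ext q
  rw [rootH_coeff]
  have hk' : (k : ℚ) ≠ 0 := by positivity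
  by_cases h : ∃ m : ℕ, (m : ℚ) = k * q
  · obtain ⟨m, hm⟩ := h
    rw [← hm, HahnSeries.ofPowerSeries_apply_coeff]
    by_cases hd : k ∣ m
    · obtain ⟨j, rfl⟩ := hd
      rw [PowerSeries.coeff_expand_mul]
      have : q = j := by
        push_cast at hm
        exact (mul_left_cancel₀ hk' hm).symm
      rw [this, HahnSeries.ofPowerSeries_apply_coeff]
    · rw [PowerSeries.coeff_expand_of_not_dvd _ _ _ hd, iotaH_coeff_of_not]
      intro j hj
      apply hd
      refine ⟨j, ?_⟩
      rw [← hj] at hm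
      exact_mod_cast hm
  · push Not at h
    rw [iotaH_coeff_of_not _ _ h, iotaH_coeff_of_not]
    intro j hj
    apply h (k * j)
    push_cast
    rw [hj]

theorem tschirnhaus (n : ℕ) (hn0 : 0 < n) (F : PS[X]) (hF : F.Monic) (hn : F.natDegree = n) :
    ∃ a : PS, (taylor a F).coeff (n - 1) = 0 := by
  have hnC : (n : ℂ) ≠ 0 := by exact_mod_cast hn0.ne'
  refine ⟨-(PowerSeries.C ((n : ℂ)⁻¹) * F.coeff (n - 1)), ?_⟩
  rw [taylor_coeff]
  have hdeg : (hasseDeriv (n - 1) F).natDegree < 2 := by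
    have := natDegree_hasseDeriv_le F (n - 1)
    omega
  rw [eval_eq_sum_range' hdeg, Finset.sum_range_succ, Finset.sum_range_one, hasseDeriv_coeff,
    hasseDeriv_coeff]
  have h1 : 1 + (n - 1) = n := by omega
  have h2 : F.coeff n = 1 := by rw [← hn]; exact hF.coeff_natDegree
  have h3 : n.choose (n - 1) = n := by
    rw [Nat.choose_symm_of_eq_add (b := 1) (by omega), Nat.choose_one_right]
  rw [h1, h2, zero_add, Nat.choose_self, h3]
  have h4 : (n : PS) * PowerSeries.C ((n : ℂ)⁻¹) = 1 := by
    rw [show (n : PS) = PowerSeries.C (n : ℂ) by simp, ← map_mul, mul_inv_cancel₀ hnC, map_one]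
  simp only [Nat.cast_one, pow_zero, mul_one, one_mul, pow_one]
  linear_combination (-F.coeff (n - 1)) * h4

theorem rescale_lemma (n : ℕ) (F : PS[X]) (hF : F.Monic) (hn : F.natDegree = n)
    (hne : ∃ i < n, F.coeff i ≠ 0) (hsub : F.coeff (n - 1) = 0) :
    ∃ (k : ℕ) (hk : k ≠ 0) (m : ℕ) (G : PS[X]), G.Monic ∧ G.natDegree = n ∧
      F.map ((PowerSeries.expand k hk : PS →ₐ[ℂ] PS) : PS →+* PS) = G.scaleRoots (PowerSeries.X ^ m) ∧
      G.coeff (n - 1) = 0 ∧ ∃ i < n, PowerSeries.constantCoeff (G.coeff i) ≠ 0 := by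
  classical
  let S : Finset ℕ := (Finset.range n).filter fun i => F.coeff i ≠ 0
  have hS : S.Nonempty := by
    obtain ⟨i, hi, h⟩ := hne
    exact ⟨i, by simp [S, hi, h]⟩
  obtain ⟨i0, hi0, hmin⟩ := S.exists_min_image
    (fun i => ((F.coeff i).order.toNat : ℚ) / ((n : ℚ) - i)) hS
  have hi0n : i0 < n := by simpa using (Finset.mem_filter.1 hi0).1
  have hi0c : F.coeff i0 ≠ 0 := (Finset.mem_filter.1 hi0).2
  have hk : n - i0 ≠ 0 := by omega
  set k := n - i0 with hkdef
  set m := (F.coeff i0).order.toNat with hm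
  have hord0 : (F.coeff i0).order = m := by
    rw [hm, ENat.natCast_toNat]
    simpa [PowerSeries.order_eq_top] using hi0c
  have hdvd : ∀ i, i < n → PowerSeries.X ^ (m * (n - i)) ∣ PowerSeries.expand k hk (F.coeff i) := by
    intro i hi
    by_cases h0 : F.coeff i = 0
    · rw [h0, map_zero]; exact dvd_zero _
    have hord : (F.coeff i).order = (F.coeff i).order.toNat := by
      rw [ENat.natCast_toNat]
      simpa [PowerSeries.order_eq_top] using h0
    set v := (F.coeff i).order.toNat with hv
    have h1 := hmin i (by simp [S, hi, h0])
    have h2 : m * (n - i) ≤ k * v := by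
      have hp1 : (0 : ℚ) < (n : ℚ) - i0 := by
        have : (i0 : ℚ) < n := by exact_mod_cast hi0n
        linarith
      have hp2 : (0 : ℚ) < (n : ℚ) - i := by
        have : (i : ℚ) < n := by exact_mod_cast hi
        linarith
      rw [div_le_div_iff₀ hp1 hp2] at h1
      have h3 : ((m * (n - i) : ℕ) : ℚ) ≤ ((k * v : ℕ) : ℚ) := by
        rw [hkdef]
        push_cast [hi.le, hi0n.le]
        linarith
      exact_mod_cast h3
    rw [PowerSeries.X_pow_dvd_iff]
    intro j hj
    apply PowerSeries.coeff_of_lt_order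
    rw [PowerSeries.order_expand, hord]
    simp only [nsmul_eq_mul]
    exact_mod_cast lt_of_lt_of_le hj h2
  choose! b hb using hdvd
  let b' : ℕ → PS := fun i => if i < n then (if F.coeff i = 0 then 0 else b i) else 0
  have hb' : ∀ i < n, PowerSeries.expand k hk (F.coeff i) = PowerSeries.X ^ (m * (n - i)) * b' i := by
    intro i hi
    simp only [b', if_pos hi]
    split_ifs with h
    · rw [h]; simp
    · exact hb i hi
  let R : PS[X] := ∑ i ∈ Finset.range n, C (b' i) * X ^ i
  have hRc : ∀ i, R.coeff i = b' i := by
    intro i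
    simp only [R, finsetSum_coeff, coeff_C_mul, coeff_X_pow, mul_ite, mul_one, mul_zero]
    rw [Finset.sum_ite_eq]
    simp only [Finset.mem_range, b']
    split_ifs <;> rfl
  have hRd : R.degree < n := by
    rw [degree_lt_iff_coeff_zero]
    intro i hi
    rw [hRc]
    simp only [b']
    rw [if_neg (by omega)]
  let G : PS[X] := X ^ n + R
  have hGm : G.Monic := monic_X_pow_add hRd
  have hGd : G.natDegree = n := by
    apply natDegree_eq_of_degree_eq_some
    rw [degree_add_eq_left_of_degree_lt (by rwa [degree_X_pow]), degree_X_pow]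
  have hGc : ∀ i < n, G.coeff i = b' i := by
    intro i hi
    simp only [G, coeff_add, coeff_X_pow, hRc]
    rw [if_neg hi.ne, zero_add]
  refine ⟨k, hk, m, G, hGm, hGd, ?_, ?_, i0, hi0n, ?_⟩
  · ext1 i
    rw [coeff_map, coeff_scaleRoots, hGd]
    rcases lt_trichotomy i n with h | h | h
    · rw [hGc i h, ← pow_mul]
      rw [mul_comm (b' i)]
      exact hb' i h
    · have h1 : F.coeff n = 1 := by rw [← hn]; exact hF.coeff_natDegree
      have h2 : G.coeff n = 1 := by
        have := hGm.coeff_natDegree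
        rwa [hGd] at this
      rw [h, h1, h2]; simp
    · rw [coeff_eq_zero_of_natDegree_lt (by omega), coeff_eq_zero_of_natDegree_lt (by omega)]
      simp
  · rw [hGc _ (by omega)]
    simp [b', hsub]
  · rw [hGc _ hi0n]
    have h1 := congrArg PowerSeries.order (hb' i0 hi0n)
    rw [PowerSeries.order_expand, hord0, PowerSeries.order_mul, PowerSeries.order_X_pow] at h1
    intro h2
    have h3 : (1 : ℕ∞) ≤ (b' i0).order := by
      rw [Order.one_le_iff_ne_zero]
      intro h4
      exact (PowerSeries.order_ne_zero_iff_constCoeff_eq_zero.2 h2) h4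
    have h4 : ((k * m + 1 : ℕ) : ℕ∞) ≤ ((k * m : ℕ) : ℕ∞) := by
      calc ((k * m + 1 : ℕ) : ℕ∞) = ((m * (n - i0) : ℕ) : ℕ∞) + 1 := by
            rw [← hkdef, mul_comm m k]; push_cast; rfl
        _ ≤ ((m * (n - i0) : ℕ) : ℕ∞) + (b' i0).order := by gcongr
        _ = ((k * m : ℕ) : ℕ∞) := by
            rw [← h1]; simp
    have h5 : k * m + 1 ≤ k * m := by exact_mod_cast h4
    omega

theorem splits_iota (n : ℕ) : ∀ F : PS[X], F.Monic → F.natDegree = n → (F.map iotaH).Splits := by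
  induction n using Nat.strong_induction_on with
  | _ n ih =>
    intro F hF hn
    rcases Nat.eq_zero_or_pos n with h0 | hpos
    · apply Splits.of_natDegree_eq_zero
      rw [hF.natDegree_map, hn, h0]
    obtain ⟨a, ha⟩ := tschirnhaus n hpos F hF hn
    set F1 := taylor a F with hF1
    have hF1m : F1.Monic := by
      rw [Monic, hF1, leadingCoeff_taylor]; exact hF
    have hF1d : F1.natDegree = n := by rw [hF1, natDegree_taylor, hn]
    suffices h : (F1.map iotaH).Splits by
      have h2 := h.taylor (-(iotaH a))
      rw [hF1, map_taylor, taylor_taylor, neg_add_cancel, taylor_zero] at h2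
      exact h2
    by_cases hz : ∀ i < n, F1.coeff i = 0
    · have : F1 = X ^ n := by
        ext1 i
        rw [coeff_X_pow]
        split_ifs with h
        · rw [h, ← hF1d]; exact hF1m.coeff_natDegree
        · rcases lt_or_gt_of_ne h with h | h
          · exact hz i h
          · exact coeff_eq_zero_of_natDegree_lt (by omega)
      rw [this, Polynomial.map_pow, map_X]
      exact Splits.X_pow n
    push Not at hz
    obtain ⟨k, hk, m, G, hGm, hGd, hscale, hGsub, i0, hi0, hGi0⟩ :=
      rescale_lemma n F1 hF1m hF1d hz ha
    suffices h : (G.map iotaH).Splits by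
      have h2 := (h.scaleRoots (iotaH (PowerSeries.X ^ m))).map (rootH k hk)
      rw [← map_scaleRoots _ _ _ (by rw [hGm.leadingCoeff, map_one]; exact one_ne_zero),
        ← hscale, Polynomial.map_map, Polynomial.map_map] at h2
      have h3 : ((rootH k hk).comp iotaH).comp ((PowerSeries.expand k hk : PS →ₐ[ℂ] PS) : PS →+* PS) = iotaH := by
        ext1 f
        exact rootH_iotaH k hk f
      rwa [h3] at h2
    -- reduction
    have hGr : (G.map PowerSeries.constantCoeff).Monic := hGm.map _
    have hGrd : (G.map PowerSeries.constantCoeff).natDegree = n := by rw [hGm.natDegree_map, hGd]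
    obtain ⟨c, hc⟩ := IsAlgClosed.exists_root (G.map PowerSeries.constantCoeff) (by
      rw [degree_eq_natDegree hGr.ne_zero, hGrd]
      exact_mod_cast hpos.ne')
    set G1 := taylor (PowerSeries.C c : PS) G with hG1
    have hG1m : G1.Monic := by
      rw [Monic, hG1, leadingCoeff_taylor]; exact hGm
    have hG1d : G1.natDegree = n := by rw [hG1, natDegree_taylor, hGd]
    have hG1r : G1.map PowerSeries.constantCoeff = taylor c (G.map PowerSeries.constantCoeff) := by
      rw [hG1, map_taylor, PowerSeries.constantCoeff_C]
    obtain ⟨P, Q, hP, hQ, hPd, hQd, hPQ⟩ := factor_lemma n G1 hG1m hG1d (by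
      rw [← coeff_map, hG1r, taylor_coeff_zero]
      exact hc) (by
      by_contra hcon
      push Not at hcon
      have h1 : taylor c (G.map PowerSeries.constantCoeff) = X ^ n := by
        rw [← hG1r]
        ext1 i
        rw [coeff_X_pow, coeff_map]
        split_ifs with h
        · rw [h]
          nth_rewrite 1 [← hG1d]
          rw [hG1m.coeff_natDegree, map_one]
        · rcases lt_or_gt_of_ne h with h | h
          · exact hcon i h
          · rw [coeff_eq_zero_of_natDegree_lt (by omega), map_zero]
      have h2 : G.map PowerSeries.constantCoeff = (X + C (-c)) ^ n := by
        have := congrArg (taylor (-c)) h1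
        rwa [taylor_taylor, neg_add_cancel, taylor_zero, taylor_X_pow] at this
      have h3 : (G.map PowerSeries.constantCoeff).coeff (n - 1) = 0 := by
        rw [coeff_map, hGsub, map_zero]
      rw [h2, coeff_X_add_C_pow, show n - (n - 1) = 1 by omega, pow_one,
        Nat.choose_symm_of_eq_add (b := 1) (by omega), Nat.choose_one_right] at h3
      have hc0 : c = 0 := by
        rcases mul_eq_zero.1 h3 with h | h
        · exact neg_eq_zero.1 h
        · exact absurd (Nat.cast_eq_zero.1 h) hpos.ne'
      apply hGi0
      rw [← coeff_map, h2, hc0, neg_zero, C_0, add_zero, coeff_X_pow, if_neg hi0.ne])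
    have h1 : (G1.map iotaH).Splits := by
      rw [hPQ, Polynomial.map_mul]
      exact (ih _ hPd P hP rfl).mul (ih _ hQd Q hQ rfl)
    have h2 := h1.taylor (-(iotaH (PowerSeries.C c)))
    rw [hG1, map_taylor, taylor_taylor, neg_add_cancel, taylor_zero] at h2
    exact h2

end Milnor
end

section
open Polynomial

namespace Milnor

/-- valuation on Hahn series -/
abbrev vH : AddValuation HH (WithTop ℚ) := HahnSeries.addVal ℚ ℂ

/-- support of the image of `t d/dt` -/
theorem DH_supp (x : HH) : (Function.support fun q : ℚ => (q : ℂ) * x.coeff q) ⊆ x.support := by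
  intro q hq
  simp only [Function.mem_support, ne_eq, mul_eq_zero, not_or] at hq
  exact hq.2

/-- the derivation `t d/dt` -/
def DH0 (x : HH) : HH where
  coeff q := (q : ℂ) * x.coeff q
  isPWO_support' := x.isPWO_support.mono (DH_supp x)

theorem DH0_coeff (x : HH) (q : ℚ) : (DH0 x).coeff q = (q : ℂ) * x.coeff q := rfl

/-- the derivation `t d/dt`, as an additive map -/
def DH : HH →+ HH where
  toFun := DH0
  map_zero' := by
    ext q
    simp only [DH0_coeff, HahnSeries.coeff_zero, mul_zero]
  map_add' x y := by
    ext q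
    simp only [DH0_coeff, HahnSeries.coeff_add]
    ring

theorem DH_mul (x y : HH) : DH (x * y) = x * DH y + DH x * y := by
  ext q
  change (DH0 (x * y)).coeff q = (x * DH0 y + DH0 x * y).coeff q
  rw [DH0_coeff, HahnSeries.coeff_add, HahnSeries.coeff_mul,
    HahnSeries.coeff_mul_right' (y := DH0 y) y.isPWO_support (DH_supp y),
    HahnSeries.coeff_mul_left' (x := DH0 x) x.isPWO_support (DH_supp x), Finset.mul_sum, ← Finset.sum_add_distrib]
  apply Finset.sum_congr rfl
  intro p hp
  have h : p.1 + p.2 = q := by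
    rw [Finset.mem_antidiagonal] at hp
    exact hp.2.2
  rw [DH0_coeff, DH0_coeff, ← h]
  push_cast
  ring

theorem DH_coeff (x : HH) (q : ℚ) : (DH x).coeff q = (q : ℂ) * x.coeff q := rfl

theorem vH_le_iff (x : HH) (i : WithTop ℚ) : i ≤ vH x ↔ ∀ j : ℚ, (j : WithTop ℚ) < i → x.coeff j = 0 := by
  rw [HahnSeries.addVal_apply, HahnSeries.le_orderTop_iff_forall]

theorem vH_DH (x : HH) : vH x ≤ vH (DH x) := by
  rw [vH_le_iff]
  intro j hj
  rw [DH_coeff, HahnSeries.coeff_eq_zero_of_lt_orderTop hj, mul_zero]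

/-- the constants in `HH` -/
abbrev CH : ℂ →+* HH := HahnSeries.C

theorem vH_C (c : ℂ) : 0 ≤ vH (CH c) := HahnSeries.orderTop_single_le

theorem vH_C_ne {c : ℂ} (hc : c ≠ 0) : vH (CH c) = 0 := HahnSeries.orderTop_single hc

theorem DH_C (c : ℂ) : DH (CH c) = 0 := by
  ext q
  rw [DH_coeff, HahnSeries.C_apply, HahnSeries.coeff_single]
  split_ifs with h
  · rw [h]; simp
  · simp

/-- `x` is regular with value `a` at `0` -/
def Res (x : HH) (a : ℂ) : Prop := 0 < vH (x - CH a)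

theorem Res.vH_nonneg {x : HH} {a : ℂ} (h : Res x a) : 0 ≤ vH x := by
  have : x = (x - CH a) + CH a := by ring
  rw [this]
  exact (le_min h.le (vH_C a)).trans (vH.map_add _ _)

theorem vH_mul_pos {x y : HH} (hx : 0 ≤ vH x) (hy : 0 < vH y) : 0 < vH (x * y) := by
  rw [vH.map_mul]
  exact lt_of_lt_of_le hy (le_add_of_nonneg_left hx)

theorem vH_add_pos {x y : HH} (hx : 0 < vH x) (hy : 0 < vH y) : 0 < vH (x + y) :=
  (lt_min hx hy).trans_le (vH.map_add _ _)

theorem Res.add {x y : HH} {a b : ℂ} (hx : Res x a) (hy : Res y b) : Res (x + y) (a + b) := by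
  have : x + y - CH (a + b) = (x - CH a) + (y - CH b) := by rw [map_add]; ring
  rw [Res, this]
  exact vH_add_pos hx hy

theorem Res.mul {x y : HH} {a b : ℂ} (hx : Res x a) (hy : Res y b) : Res (x * y) (a * b) := by
  have : x * y - CH (a * b) = x * (y - CH b) + CH b * (x - CH a) := by rw [map_mul]; ring
  rw [Res, this]
  exact vH_add_pos (vH_mul_pos hx.vH_nonneg hy) (vH_mul_pos (vH_C b) hx)

theorem Res.const (a : ℂ) : Res (CH a) a := by
  rw [Res, sub_self, AddValuation.map_zero]
  exact WithTop.coe_lt_top 0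

theorem Res.unique {x : HH} {a b : ℂ} (hx : Res x a) (hy : Res x b) : a = b := by
  by_contra h
  have h1 : 0 < vH (CH (a - b)) := by
    have : CH (a - b) = (x - CH b) + CH (-1) * (x - CH a) := by
      rw [map_sub, map_neg, map_one]; ring
    rw [this]
    exact vH_add_pos hy (vH_mul_pos (vH_C _) hx)
  rw [vH_C_ne (sub_ne_zero.2 h)] at h1
  exact lt_irrefl _ h1

theorem Res.sum {ι : Type*} (s : Finset ι) (f : ι → HH) (a : ι → ℂ) (h : ∀ i ∈ s, Res (f i) (a i)) :
    Res (∑ i ∈ s, f i) (∑ i ∈ s, a i) := by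
  classical
  induction s using Finset.induction_on with
  | empty => simpa using Res.const 0
  | insert i s his ih =>
    rw [Finset.sum_insert his, Finset.sum_insert his]
    exact (h i (Finset.mem_insert_self _ _)).add (ih fun j hj => h j (Finset.mem_insert_of_mem hj))

theorem Res.deriv {x : HH} {a : ℂ} (hx : Res x a) : Res (DH x) 0 := by
  have : DH x - CH 0 = DH (x - CH a) := by rw [map_zero, sub_zero, map_sub, DH_C, sub_zero]
  rw [Res, this]
  exact hx.trans_le (vH_DH _)

theorem Res.of_nonneg {x : HH} (hx : 0 ≤ vH x) : Res x (x.coeff 0) := by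
  by_contra h
  rw [Res, not_lt] at h
  by_cases h0 : x - CH (x.coeff 0) = 0
  · rw [h0, AddValuation.map_zero] at h
    exact absurd h (by simp)
  have h1 : 0 ≤ vH (x - CH (x.coeff 0)) := by
    refine le_trans (le_min hx (vH_C _)) (vH.map_sub _ _)
  have h2 : vH (x - CH (x.coeff 0)) = ((0 : ℚ) : WithTop ℚ) := le_antisymm h h1
  have h3 := HahnSeries.coeff_orderTop_ne h2
  apply h3
  rw [HahnSeries.coeff_sub, HahnSeries.C_apply, HahnSeries.coeff_single, if_pos rfl, sub_self]

theorem Res.logderiv {x : HH} (hx : x ≠ 0) : Res (DH x / x) (x.order : ℂ) := by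
  rw [Res]
  have hv : vH x = (x.order : WithTop ℚ) := HahnSeries.addVal_apply_of_ne hx
  have h1 : (DH x / x - CH (x.order : ℂ)) * x = DH x - CH (x.order : ℂ) * x := by
    field_simp
  have h2 : vH (DH x / x - CH (x.order : ℂ)) + vH x = vH (DH x - CH (x.order : ℂ) * x) := by
    rw [← h1, vH.map_mul]
  by_contra hcon
  rw [not_lt] at hcon
  have h3 : vH (DH x - CH (x.order : ℂ) * x) ≤ x.order := by
    rw [← h2, hv]
    calc _ ≤ (0 : WithTop ℚ) + x.order := by gcongr
      _ = _ := zero_add _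
  obtain ⟨g, hg⟩ := WithTop.ne_top_iff_exists.1 (ne_top_of_le_ne_top (WithTop.coe_ne_top) h3)
  have h4 := HahnSeries.coeff_orderTop_ne hg.symm
  rw [← hg] at h3
  have h5 : g ≤ x.order := by exact_mod_cast h3
  apply h4
  rw [HahnSeries.coeff_sub, DH_coeff, HahnSeries.C_mul_eq_smul, HahnSeries.coeff_smul, smul_eq_mul,
    ← sub_mul]
  rcases h5.eq_or_lt with h | h
  · rw [h, sub_self, zero_mul]
  · rw [HahnSeries.coeff_eq_zero_of_lt_order h, mul_zero]

theorem vH_of_integral (y : HH) (p : HH[X]) (hp : p.Monic) (hc : ∀ i, 0 ≤ vH (p.coeff i))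
    (hy : p.eval y = 0) : 0 ≤ vH y := by
  by_contra hcon
  rw [not_le] at hcon
  obtain ⟨q, hq⟩ := WithTop.ne_top_iff_exists.1 (ne_top_of_lt hcon)
  have hq0 : q < 0 := by
    rw [← hq] at hcon
    exact_mod_cast hcon
  have hpow : ∀ i : ℕ, vH (y ^ i) = ((i * q : ℚ) : WithTop ℚ) := by
    intro i
    rw [vH.map_pow, ← hq, ← WithTop.coe_nsmul, nsmul_eq_mul]
  have hsum : y ^ p.natDegree = - ∑ i ∈ Finset.range p.natDegree, p.coeff i * y ^ i := by
    rw [eval_eq_sum_range, Finset.sum_range_succ, hp.coeff_natDegree, one_mul] at hy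
    linear_combination hy
  have h1 : vH (y ^ p.natDegree) < vH (- ∑ i ∈ Finset.range p.natDegree, p.coeff i * y ^ i) := by
    rw [vH.map_neg]
    apply AddValuation.map_lt_sum
    · rw [hpow]; exact WithTop.coe_ne_top
    intro i hi
    rw [vH.map_mul, hpow, hpow]
    have h2 : ((p.natDegree * q : ℚ) : WithTop ℚ) < ((i * q : ℚ) : WithTop ℚ) := by
      rw [WithTop.coe_lt_coe]
      have : (i : ℚ) < p.natDegree := by exact_mod_cast Finset.mem_range.1 hi
      nlinarith
    calc _ < ((i * q : ℚ) : WithTop ℚ) := h2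
      _ = 0 + ((i * q : ℚ) : WithTop ℚ) := (zero_add _).symm
      _ ≤ _ := by gcongr; exact hc i
  rw [← hsum] at h1
  exact lt_irrefl _ h1

theorem vH_iota (f : PS) : 0 ≤ vH (iotaH f) := by
  rw [vH_le_iff]
  intro j hj
  apply iotaH_coeff_of_not
  intro m hm
  rw [← hm] at hj
  have : (m : ℚ) < 0 := by exact_mod_cast hj
  exact absurd this (by simp)

end Milnor
end

section
open Polynomial

set_option linter.style.haveILetI false

namespace Milnor

theorem exists_dvd_ne {R T : Type*} [CommRing R] [CommRing T] [IsDomain T] [Algebra R T]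
    [Algebra.IsIntegral R T] (x : T) (hx : x ≠ 0) :
    ∃ r : R, algebraMap R T r ≠ 0 ∧ ∃ y, x * y = algebraMap R T r := by
  obtain ⟨p, hp, hpx⟩ := Algebra.IsIntegral.isIntegral (R := R) x
  have h1 : (p.map (algebraMap R T).rangeRestrict) ≠ 0 := (hp.map _).ne_zero
  have h2 : (p.map (algebraMap R T).rangeRestrict).eval₂ (algebraMap R T).range.subtype x = 0 := by
    rw [eval₂_map]
    exact hpx
  obtain ⟨i, hi, hmem⟩ := Ideal.exists_coeff_ne_zero_mem_comap_of_root_mem hx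
    (Ideal.mem_span_singleton_self x) h1 h2
  rw [Ideal.mem_comap, Ideal.mem_span_singleton'] at hmem
  obtain ⟨y, hy⟩ := hmem
  obtain ⟨r, hr⟩ := ((p.map (algebraMap R T).rangeRestrict).coeff i).2
  refine ⟨r, ?_, y, ?_⟩
  · rw [hr]
    intro h
    exact hi (Subtype.ext h)
  · rw [hr, mul_comm, hy]; rfl

theorem mem_range_of_integral (y : AlgebraicClosure HH)
    (hy : ((algebraMap HH (AlgebraicClosure HH)).comp iotaH).IsIntegralElem y) :
    ∃ z : HH, algebraMap HH _ z = y ∧ iotaH.IsIntegralElem z := by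
  obtain ⟨F, hF, hFy⟩ := hy
  have hs := splits_iota F.natDegree F hF rfl
  have hne : F.map iotaH ≠ 0 := (hF.map _).ne_zero
  have h2 : (F.map iotaH).eval₂ (algebraMap HH (AlgebraicClosure HH)) y = 0 := by
    rw [eval₂_map]; exact hFy
  have h3 := hs.mem_range_of_isRoot (i := algebraMap HH (AlgebraicClosure HH)) hne
    (x := y) (by rw [IsRoot.def, eval_map]; exact h2)
  obtain ⟨z, hz⟩ := h3
  refine ⟨z, hz, F, hF, ?_⟩
  apply (algebraMap HH (AlgebraicClosure HH)).injective
  rw [hom_eval₂, hz, map_zero]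
  exact hFy

theorem alg_lift {A B K : Type*} [CommRing A] [CommRing B] [IsDomain B] [Field K] [IsAlgClosed K]
    [Algebra A B] [Algebra A K] [Algebra.IsIntegral A B]
    (hAB : Function.Injective (algebraMap A B)) (hAK : Function.Injective (algebraMap A K)) :
    Nonempty (B →ₐ[A] K) := by
  haveI : IsDomain A := hAB.isDomain _
  haveI : FaithfulSMul A B := (faithfulSMul_iff_algebraMap_injective A B).2 hAB
  haveI : FaithfulSMul A K := (faithfulSMul_iff_algebraMap_injective A K).2 hAK
  exact ⟨IsAlgClosed.lift⟩

theorem extend_hom {R T : Type*} [CommRing R] [CommRing T] [Algebra R T]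
    [Algebra.IsIntegral R T] (φ1 : R →+* HH) (hk : RingHom.ker (algebraMap R T) ≤ RingHom.ker φ1)
    (hintg : ∀ r, iotaH.IsIntegralElem (φ1 r)) :
    ∃ φ : T →+* HH, (∀ r, φ (algebraMap R T r) = φ1 r) ∧ ∀ t, iotaH.IsIntegralElem (φ t) := by
  haveI : (RingHom.ker φ1).IsPrime := RingHom.ker_isPrime φ1
  obtain ⟨Q, -, hQ, hQ1⟩ := Ideal.exists_ideal_over_prime_of_isIntegral (S := T) (RingHom.ker φ1) ⊥ hk
  let A := R ⧸ RingHom.ker φ1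
  let B := T ⧸ Q
  let K := AlgebraicClosure HH
  letI : Algebra A B := (Ideal.quotientMap Q (algebraMap R T) hQ1.ge).toAlgebra
  let k : A →+* K := (algebraMap HH K).comp (RingHom.kerLift φ1)
  letI : Algebra A K := k.toAlgebra
  haveI : IsDomain B := Ideal.Quotient.isDomain Q
  have iAB : Function.Injective (algebraMap A B) :=
    Ideal.quotientMap_injective' (H := hQ1.ge) hQ1.le
  have iAK : Function.Injective (algebraMap A K) :=
    (algebraMap HH K).injective.comp (RingHom.kerLift_injective φ1)
  have hAB : ∀ r : R, algebraMap A B (Ideal.Quotient.mk _ r) = Ideal.Quotient.mk Q (algebraMap R T r) := 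
    fun r => Ideal.quotientMap_mk
  haveI : Algebra.IsIntegral A B := by
    constructor
    intro b
    obtain ⟨t, rfl⟩ := Ideal.Quotient.mk_surjective b
    obtain ⟨p, hp, hpx⟩ := Algebra.IsIntegral.isIntegral (R := R) t
    refine ⟨p.map (Ideal.Quotient.mk _), hp.map _, ?_⟩
    rw [eval₂_map]
    have : (algebraMap A B).comp (Ideal.Quotient.mk (RingHom.ker φ1)) =
      (Ideal.Quotient.mk Q).comp (algebraMap R T) := RingHom.ext hAB
    rw [this, ← hom_eval₂, hpx, map_zero]
  obtain ⟨Φ⟩ := alg_lift (A := A) (B := B) (K := K) iAB iAK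
  have hΦ : ∀ b : B, ((algebraMap HH K).comp iotaH).IsIntegralElem (Φ b) := by
    intro b
    have h1 : k.IsIntegralElem (Φ b) := (Algebra.IsIntegral.isIntegral (R := A) b).map Φ
    letI : Algebra PS K := ((algebraMap HH K).comp iotaH).toAlgebra
    have h2 : ∀ a : A, IsIntegral PS (k a) := by
      intro a
      obtain ⟨r, rfl⟩ := Ideal.Quotient.mk_surjective a
      obtain ⟨p, hp, hpx⟩ := hintg r
      refine ⟨p, hp, ?_⟩
      change p.eval₂ ((algebraMap HH K).comp iotaH) (algebraMap HH K (φ1 r)) = 0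
      rw [← hom_eval₂, hpx, map_zero]
    obtain ⟨p, hp, hpx⟩ := h1
    have hC : ∀ i, IsIntegral PS ((p.map k).coeff i) := fun i => by rw [coeff_map]; exact h2 _
    change IsIntegral PS (Φ b)
    let C := integralClosure PS K
    have h4 : IsIntegral C (Φ b) := by
      have : p.map k ∈ Polynomial.lifts (algebraMap C K) := by
        rw [Polynomial.lifts_iff_coeff_lifts]
        intro i
        exact ⟨⟨_, hC i⟩, rfl⟩
      obtain ⟨q, hq, hq1, hq2⟩ := Polynomial.lifts_and_degree_eq_and_monic this (hp.map k)
      refine ⟨q, hq2, ?_⟩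
      rw [← eval_map, hq, eval_map, hpx]
    exact isIntegral_trans (A := C) _ h4
  choose z hz1 hz2 using fun b => mem_range_of_integral (Φ b) (hΦ b)
  have hinj : Function.Injective (algebraMap HH K) := (algebraMap HH K).injective
  let φB : B →+* HH :=
    { toFun := z
      map_one' := hinj (by rw [hz1, map_one, map_one])
      map_zero' := hinj (by rw [hz1, map_zero, map_zero])
      map_add' := fun a b => hinj (by rw [map_add, hz1, hz1, hz1, map_add])
      map_mul' := fun a b => hinj (by rw [map_mul, hz1, hz1, hz1, map_mul]) }
  refine ⟨φB.comp (Ideal.Quotient.mk Q), ?_, fun t => hz2 _⟩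
  intro r
  apply hinj
  change algebraMap HH K (z _) = _
  rw [hz1, ← hAB, Φ.commutes]
  rfl

end Milnor
end

section
open Topology Filter

set_option linter.style.haveILetI false
namespace Milnor

section
variable {V : Type*} [NormedAddCommGroup V] [NormedSpace ℂ V]

variable (V) in
/-- functions analytic at `0` -/
def An : Subalgebra ℂ (V → ℂ) where
  carrier := {f | AnalyticAt ℂ f 0}
  mul_mem' := fun hf hg => AnalyticAt.mul hf hg
  add_mem' := fun hf hg => AnalyticAt.add hf hg
  algebraMap_mem' := fun _ => analyticAt_const

/-- Taylor coefficients along a line -/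
def psi0 (v : V) (f : V → ℂ) : PS :=
  PowerSeries.mk fun n => (n.factorial : ℂ)⁻¹ * iteratedDeriv n (fun t : ℂ => f (t • v)) 0

theorem line_an (v : V) {f : V → ℂ} (hf : AnalyticAt ℂ f 0) :
    AnalyticAt ℂ (fun t : ℂ => f (t • v)) 0 := by
  have h : AnalyticAt ℂ (fun t : ℂ => t • v) 0 := analyticAt_id.smul analyticAt_const
  refine AnalyticAt.fun_comp (g := f) ?_ h
  simpa using hf

theorem psi0_mul (v : V) {f g : V → ℂ} (hf : AnalyticAt ℂ f 0) (hg : AnalyticAt ℂ g 0) :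
    psi0 v (f * g) = psi0 v f * psi0 v g := by
  ext n
  rw [PowerSeries.coeff_mul, psi0, PowerSeries.coeff_mk]
  have h1 := iteratedDeriv_fun_mul (n := n) (line_an v hf).contDiffAt (line_an v hg).contDiffAt
  change _ * iteratedDeriv n (fun t : ℂ => f (t • v) * g (t • v)) 0 = _
  rw [h1, Finset.mul_sum, Finset.Nat.sum_antidiagonal_eq_sum_range_succ_mk]
  apply Finset.sum_congr rfl
  intro i hi
  have hi' : i ≤ n := Nat.lt_succ_iff.1 (Finset.mem_range.1 hi)
  simp only [psi0, PowerSeries.coeff_mk]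
  rw [Nat.cast_choose ℂ hi']
  have : (n.factorial : ℂ) ≠ 0 := by exact_mod_cast n.factorial_ne_zero
  field_simp

theorem psi0_add (v : V) {f g : V → ℂ} (hf : AnalyticAt ℂ f 0) (hg : AnalyticAt ℂ g 0) :
    psi0 v (f + g) = psi0 v f + psi0 v g := by
  ext n
  rw [map_add, psi0, psi0, psi0, PowerSeries.coeff_mk, PowerSeries.coeff_mk, PowerSeries.coeff_mk,
    ← mul_add]
  congr 1
  exact iteratedDeriv_fun_add (n := n) (line_an v hf).contDiffAt (line_an v hg).contDiffAt

theorem psi0_const (v : V) (c : ℂ) : psi0 v (fun _ => c) = PowerSeries.C c := by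
  ext n
  rw [psi0, PowerSeries.coeff_mk, PowerSeries.coeff_C, iteratedDeriv_const]
  by_cases h : n = 0
  · simp [h]
  · simp [h]

theorem psi0_congr (v : V) {f g : V → ℂ} (h : f =ᶠ[𝓝 0] g) : psi0 v f = psi0 v g := by
  ext n
  rw [psi0, psi0, PowerSeries.coeff_mk, PowerSeries.coeff_mk]
  congr 1
  apply Filter.EventuallyEq.iteratedDeriv_eq
  have h1 : Tendsto (fun t : ℂ => t • v) (𝓝 0) (𝓝 0) := by
    have : Continuous (fun t : ℂ => t • v) := by fun_prop
    simpa using this.tendsto 0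
  exact h1.eventually h

theorem psi0_ne (v : V) {f : V → ℂ} (hf : AnalyticAt ℂ f 0)
    (h : ¬ ∀ᶠ t : ℂ in 𝓝 0, f (t • v) = 0) : psi0 v f ≠ 0 := by
  intro h0
  apply h
  have h1 := (line_an v hf).hasFPowerSeriesAt
  have h2 : (FormalMultilinearSeries.ofScalars ℂ
      fun n => iteratedDeriv n (fun t : ℂ => f (t • v)) 0 / n.factorial) = 0 := by
    have : ∀ n, iteratedDeriv n (fun t : ℂ => f (t • v)) 0 / n.factorial = 0 := by
      intro n
      have := congrArg (PowerSeries.coeff n) h0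
      rw [psi0, PowerSeries.coeff_mk, map_zero] at this
      rw [div_eq_mul_inv, mul_comm, this]
    simp only [this]
    ext n
    simp [FormalMultilinearSeries.ofScalars]
  rw [h2] at h1
  exact h1.eventually_eq_zero

/-- Taylor series along a line, as a ring hom -/
def psi (v : V) : An V →+* PS where
  toFun f := psi0 v f.1
  map_one' := psi0_const v 1
  map_zero' := (psi0_const v 0).trans (map_zero _)
  map_add' f g := psi0_add v f.2 g.2
  map_mul' f g := psi0_mul v f.2 g.2

theorem exists_line {f : V → ℂ} (hf : AnalyticAt ℂ f 0) (h : ¬ ∀ᶠ x in 𝓝 (0:V), f x = 0) :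
    ∃ v : V, ¬ ∀ᶠ t : ℂ in 𝓝 0, f (t • v) = 0 := by
  obtain ⟨r, hr, hr1⟩ := Metric.eventually_nhds_iff_ball.1 hf.eventually_analyticAt
  have h2 : ∃ v ∈ Metric.ball (0:V) r, f v ≠ 0 := by
    by_contra hcon
    push Not at hcon
    exact h (Metric.eventually_nhds_iff_ball.2 ⟨r, hr, hcon⟩)
  obtain ⟨v, hv, hv0⟩ := h2
  refine ⟨v, fun hev => hv0 ?_⟩
  let U : Set ℂ := (fun t : ℂ => t • v) ⁻¹' Metric.ball (0:V) r
  have hU : Convex ℝ U := by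
    have : IsLinearMap ℝ (fun t : ℂ => t • v) :=
      ⟨fun a b => add_smul a b v, fun c a => by rw [smul_assoc]⟩
    exact (convex_ball _ _).is_linear_preimage this
  have han : AnalyticOnNhd ℂ (fun t : ℂ => f (t • v)) U := by
    intro t ht
    exact AnalyticAt.fun_comp (g := f) (hr1 _ ht) (analyticAt_id.smul analyticAt_const)
  have h0 : (0:ℂ) ∈ U := by simp [U, hr]
  have h1 : (1:ℂ) ∈ U := by simpa [U] using hv
  have := han.eqOn_zero_of_preconnected_of_eventuallyEq_zero hU.isPreconnected h0 hev h1
  simpa using this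

/-- the prime ideal of an ultrafilter -/
def PU (𝒰 : Ultrafilter V) : Ideal (An V) where
  carrier := {f | ∀ᶠ x in (𝒰 : Filter V), f.1 x = 0}
  add_mem' := by
    intro a b ha hb
    filter_upwards [ha, hb] with x hx hy
    change a.1 x + b.1 x = 0
    rw [hx, hy, add_zero]
  zero_mem' := Eventually.of_forall fun _ => rfl
  smul_mem' := by
    intro c a ha
    filter_upwards [ha] with x hx
    change c.1 x * a.1 x = 0
    rw [hx, mul_zero]

theorem mem_PU {𝒰 : Ultrafilter V} {f : An V} : f ∈ PU 𝒰 ↔ ∀ᶠ x in (𝒰 : Filter V), f.1 x = 0 := Iff.rfl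

instance PU_prime (𝒰 : Ultrafilter V) : (PU 𝒰).IsPrime := by
  constructor
  · intro h
    have h1 : (1 : An V) ∈ PU 𝒰 := h ▸ Submodule.mem_top
    have := (mem_PU.1 h1).exists
    obtain ⟨x, hx⟩ := this
    exact one_ne_zero (α := ℂ) hx
  · intro f g h
    rw [mem_PU] at h
    rw [mem_PU, mem_PU, ← Ultrafilter.eventually_or]
    filter_upwards [h] with x hx
    exact mul_eq_zero.1 hx

end

theorem step_aux {R S : Type*} [CommRing R] [CommRing S] (f : R →+* S) (P : Ideal S) [P.IsPrime]
    (n : ℕ) (τ : S) (hn : ∀ k : S, ∃ r : Fin n → R, k - ∑ i, f (r i) * τ ^ (i:ℕ) ∈ P)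
    (h : S) (hh : h ∉ P) : ∃ r : R, f r ∉ P ∧ ∀ φ1 : R →+* HH, (∀ u, f u ∈ P → φ1 u = 0) →
      φ1 r ≠ 0 → (∀ u, iotaH.IsIntegralElem (φ1 u)) →
      ∃ φ : S →+* HH, (∀ u, φ (f u) = φ1 u) ∧ (∀ u ∈ P, φ u = 0) ∧
        (∀ u, iotaH.IsIntegralElem (φ u)) ∧ φ h ≠ 0 := by
  classical
  letI : Algebra R (S ⧸ P) := ((Ideal.Quotient.mk P).comp f).toAlgebra
  have halg : ∀ u, algebraMap R (S ⧸ P) u = Ideal.Quotient.mk P (f u) := fun _ => rfl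
  haveI : Module.Finite R (S ⧸ P) := by
    refine ⟨⟨Finset.univ.image fun i : Fin n => (Ideal.Quotient.mk P τ) ^ (i:ℕ), ?_⟩⟩
    rw [eq_top_iff]
    rintro t -
    obtain ⟨k, rfl⟩ := Ideal.Quotient.mk_surjective t
    obtain ⟨r, hr⟩ := hn k
    have : Ideal.Quotient.mk P k =
        ∑ i : Fin n, r i • (Ideal.Quotient.mk P τ) ^ (i:ℕ) := by
      rw [← Ideal.Quotient.eq] at hr
      rw [hr, map_sum]
      apply Finset.sum_congr rfl
      intro i _
      rw [Algebra.smul_def, map_mul, map_pow, halg]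
    rw [this]
    apply Submodule.sum_mem
    intro i _
    apply Submodule.smul_mem
    apply Submodule.subset_span
    simp
  haveI : IsDomain (S ⧸ P) := Ideal.Quotient.isDomain _
  haveI : Algebra.IsIntegral R (S ⧸ P) := inferInstance
  have hne : Ideal.Quotient.mk P h ≠ 0 := fun hcon => hh (Ideal.Quotient.eq_zero_iff_mem.1 hcon)
  obtain ⟨r, hr0, y, hy⟩ := exists_dvd_ne (R := R) _ hne
  refine ⟨r, ?_, ?_⟩
  · intro hcon
    apply hr0
    rw [halg, Ideal.Quotient.eq_zero_iff_mem]
    exact hcon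
  intro φ1 hk hφr hi
  obtain ⟨φ, hφ, hφi⟩ := extend_hom (T := S ⧸ P) φ1 (by
      intro u hu
      rw [RingHom.mem_ker, halg, Ideal.Quotient.eq_zero_iff_mem] at hu
      exact hk u hu) hi
  refine ⟨φ.comp (Ideal.Quotient.mk P), hφ, ?_, fun u => hφi _, ?_⟩
  · intro u hu
    rw [RingHom.comp_apply, Ideal.Quotient.eq_zero_iff_mem.2 hu, map_zero]
  · intro hcon
    apply hφr
    rw [← hφ, ← hy, map_mul]
    rw [RingHom.comp_apply] at hcon
    rw [hcon, zero_mul]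

/-- good homomorphisms -/
structure Good {V : Type*} [NormedAddCommGroup V] [NormedSpace ℂ V] (𝒰 : Ultrafilter V)
    (φ : An V →+* HH) : Prop where
  kill : ∀ f ∈ PU 𝒰, φ f = 0
  const : ∀ c : ℂ, φ (algebraMap ℂ (An V) c) = CH c
  int : ∀ f, iotaH.IsIntegralElem (φ f)

theorem iotaH_C (c : ℂ) : iotaH (PowerSeries.C c) = CH c := HahnSeries.ofPowerSeries_C c

theorem arc_aux (d : ℕ) : ∀ (V : Type) [NormedAddCommGroup V] [NormedSpace ℂ V] [FiniteDimensional ℂ V]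
    (_ : Module.finrank ℂ V = d) (𝒰 : Ultrafilter V) (_ : (𝒰 : Filter V) ≤ 𝓝 0) (h : An V) (_ : h ∉ PU 𝒰),
    ∃ φ : An V →+* HH, Good 𝒰 φ ∧ φ h ≠ 0 := by
  induction d using Nat.strong_induction_on with
  | _ d ih =>
  intro V _ _ _ hd 𝒰 h𝒰 h hh
  by_cases hP : ∀ f ∈ PU 𝒰, ∀ᶠ x in 𝓝 (0:V), f.1 x = 0
  · -- only the zero germ
    have h1 : ¬ ∀ᶠ x in 𝓝 (0:V), h.1 x = 0 := fun hcon => hh (h𝒰 hcon)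
    obtain ⟨v, hv⟩ := exists_line h.2 h1
    refine ⟨iotaH.comp (psi v), ⟨?_, ?_, ?_⟩, ?_⟩
    · intro f hf
      change iotaH (psi0 v f.1) = 0
      have : psi0 v f.1 = psi0 v (fun _ => 0) := psi0_congr v (hP f hf)
      rw [this, psi0_const, map_zero, map_zero]
    · intro c
      change iotaH (psi0 v (fun _ => c)) = _
      rw [psi0_const, iotaH_C]
    · intro f
      exact RingHom.isIntegralElem_map iotaH
    · change iotaH (psi0 v h.1) ≠ 0
      rw [map_ne_zero_iff _ HahnSeries.ofPowerSeries_injective]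
      exact psi0_ne v h.2 hv
  · push Not at hP
    obtain ⟨f, hf, hf0⟩ := hP
    obtain ⟨v, hv⟩ := exists_line f.2 (by rw [Filter.not_eventually]; exact hf0)
    have hfz : f.1 0 = 0 := by
      have h1 : Tendsto f.1 (𝒰 : Filter V) (𝓝 (f.1 0)) := f.2.continuousAt.tendsto.mono_left h𝒰
      have h2 : Tendsto f.1 (𝒰 : Filter V) (𝓝 0) := tendsto_const_nhds.congr' (by
        filter_upwards [hf] with x hx
        exact hx.symm)
      exact tendsto_nhds_unique h1 h2
    have hvne : v ≠ 0 := by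
      rintro rfl
      apply hv
      simp [hfz]
    obtain ⟨τ, hτ⟩ := SeparatingDual.exists_eq_one (R := ℂ) hvne
    let π : V →L[ℂ] LinearMap.ker τ.toLinearMap :=
      (ContinuousLinearMap.id ℂ V - τ.smulRight v).codRestrict _ (by
        intro x
        simp [hτ])
    have hπv : ∀ x, (π x : V) + τ x • v = x := by
      intro x
      simp [π]
    have hπ0 : π 0 = 0 := map_zero _
    obtain ⟨n, hn⟩ := weierstrass_finite τ v f.1 f.2 hv π π.continuous hπ0 hπv
    let V1 := LinearMap.ker τ.toLinearMap
    let 𝒰1 : Ultrafilter V1 := 𝒰.map π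
    have h𝒰1 : (𝒰1 : Filter V1) ≤ 𝓝 0 := by
      have : Tendsto π (𝓝 0) (𝓝 0) := by simpa using π.continuous.tendsto 0
      exact this.mono_left h𝒰
    have hdim : Module.finrank ℂ V1 < d := by
      rw [← hd]
      apply Submodule.finrank_lt
      intro htop
      have : v ∈ V1 := by
        rw [htop]; trivial
      have h0 : τ v = 0 := this
      rw [hτ] at h0
      exact one_ne_zero h0
    let pull : An V1 →+* An V :=
      { toFun := fun u => ⟨fun x => u.1 (π x), AnalyticAt.fun_comp (g := u.1) (by rw [hπ0]; exact u.2)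
            (π.analyticAt 0)⟩
        map_one' := rfl
        map_zero' := rfl
        map_add' := fun _ _ => rfl
        map_mul' := fun _ _ => rfl }
    let τA : An V := ⟨fun x => τ x, τ.analyticAt 0⟩
    obtain ⟨r, hr0, H⟩ := step_aux pull (PU 𝒰) n τA (by
      intro k
      obtain ⟨r, hr, hr1⟩ := hn k.1 k.2
      refine ⟨fun i => ⟨r i, hr i⟩, ?_⟩
      rw [mem_PU]
      filter_upwards [hf, h𝒰 hr1] with x hx1 hx2
      have h3 : (∑ i : Fin n, pull ⟨r i, hr i⟩ * τA ^ (i:ℕ) : An V).1 x =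
          ∑ i, r i (π x) * τ x ^ (i:ℕ) := by
        simp [pull, τA]
      change k.1 x - (∑ i : Fin n, pull ⟨r i, hr i⟩ * τA ^ (i:ℕ) : An V).1 x = 0
      rw [h3, hx2 hx1, sub_self]) h hh
    obtain ⟨φ1, hφ1, hφr⟩ := ih _ hdim V1 rfl 𝒰1 h𝒰1 r hr0
    obtain ⟨φ, h1, h2, h3, h4⟩ := H φ1 (fun u hu => hφ1.kill u hu) hφr hφ1.int
    refine ⟨φ, ⟨h2, ?_, h3⟩, h4⟩
    intro c
    rw [← hφ1.const, ← h1]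
    rfl

theorem Good.res {V : Type*} [NormedAddCommGroup V] [NormedSpace ℂ V] {𝒰 : Ultrafilter V}
    {φ : An V →+* HH} (hφ : Good 𝒰 φ) (h𝒰 : (𝒰 : Filter V) ≤ 𝓝 0) (f : An V) : Res (φ f) (f.1 0) := by
  have hv : ∀ f, 0 ≤ vH (φ f) := by
    intro f
    obtain ⟨p, hp, hpf⟩ := hφ.int f
    refine vH_of_integral _ (p.map iotaH) (hp.map _) ?_ ?_
    · intro i
      rw [Polynomial.coeff_map]
      exact vH_iota _
    · rw [Polynomial.eval_map]
      exact hpf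
  have h1 := Res.of_nonneg (hv f)
  set a := (φ f).coeff 0 with ha
  suffices f.1 0 = a by rw [this]; exact h1
  by_contra hne
  let u : An V := f - algebraMap ℂ (An V) a
  have hu0 : u.1 0 ≠ 0 := sub_ne_zero.2 hne
  let w : An V := ⟨fun x => (u.1 x)⁻¹, AnalyticAt.inv u.2 hu0⟩
  have huw : u * w - 1 ∈ PU 𝒰 := by
    rw [mem_PU]
    have : ∀ᶠ x in 𝓝 (0:V), u.1 x ≠ 0 := AnalyticAt.continuousAt u.2 |>.eventually_ne hu0
    filter_upwards [h𝒰 this] with x hx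
    change u.1 x * (u.1 x)⁻¹ - 1 = 0
    rw [mul_inv_cancel₀ hx, sub_self]
  have h2 := hφ.kill _ huw
  rw [map_sub, map_mul, map_one, sub_eq_zero] at h2
  have h3 : φ u = φ f - CH a := by rw [map_sub, hφ.const]
  have h4 : 0 < vH (φ u * φ w) := by
    rw [mul_comm]
    apply vH_mul_pos (hv w)
    rw [h3]; exact h1
  rw [h2, AddValuation.map_one] at h4
  exact lt_irrefl _ h4

end Milnor
end

section
open Topology Filter

set_option linter.style.haveILetI false
namespace Milnor

section
variable {m : ℕ}

/-- partial derivative -/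
def pd (j : Fin m) (f : EuclideanSpace ℂ (Fin m) → ℂ) (x : EuclideanSpace ℂ (Fin m)) : ℂ :=
  fderiv ℂ f x (EuclideanSpace.single j 1)

theorem pd_an (j : Fin m) {f : EuclideanSpace ℂ (Fin m) → ℂ} {x} (hf : AnalyticAt ℂ f x) :
    AnalyticAt ℂ (pd j f) x :=
  (ContinuousLinearMap.apply ℂ ℂ (EuclideanSpace.single j (1:ℂ))).analyticAt _ |>.comp hf.fderiv

/-- partial derivative on `An` -/
def pdA (j : Fin m) (f : An (EuclideanSpace ℂ (Fin m))) : An (EuclideanSpace ℂ (Fin m)) :=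
  ⟨pd j f.1, pd_an j f.2⟩

/-- coordinate -/
def coA (j : Fin m) : An (EuclideanSpace ℂ (Fin m)) :=
  ⟨fun x => x j, (EuclideanSpace.proj (𝕜 := ℂ) j).analyticAt 0⟩

theorem clm_sum (L : EuclideanSpace ℂ (Fin m) →L[ℂ] ℂ) (x : EuclideanSpace ℂ (Fin m)) :
    L x = ∑ j, x j * L (EuclideanSpace.single j (1:ℂ)) := by
  conv_lhs => rw [← (EuclideanSpace.basisFun (Fin m) ℂ).sum_repr x]
  rw [map_sum]
  apply Finset.sum_congr rfl
  intro j _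
  rw [map_smul]
  simp

theorem hadamard (f : EuclideanSpace ℂ (Fin m) → ℂ) (hf : AnalyticAt ℂ f 0) :
    ∃ q : Fin m → An (EuclideanSpace ℂ (Fin m)),
      ∀ᶠ x in 𝓝 (0 : EuclideanSpace ℂ (Fin m)), f x = f 0 + ∑ j, x j * (q j).1 x := by
  obtain ⟨p, r, hp⟩ := hf
  have hrad : 0 < p.shift.radius := by
    rw [FormalMultilinearSeries.radius_shift]
    exact hp.r_pos.trans_le hp.r_le
  have hq := p.shift.hasFPowerSeriesOnBall hrad
  let Q := p.shift.sum
  have hQ : AnalyticAt ℂ Q 0 := hq.analyticAt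
  refine ⟨fun j => ⟨fun x => Q x (EuclideanSpace.single j (1:ℂ)),
    (ContinuousLinearMap.apply ℂ ℂ (EuclideanSpace.single j (1:ℂ))).analyticAt _ |>.comp hQ⟩, ?_⟩
  have h1 : ∀ᶠ x in 𝓝 (0 : EuclideanSpace ℂ (Fin m)), x ∈ Metric.eball 0 r :=
    Metric.eball_mem_nhds _ hp.r_pos
  have h2 : ∀ᶠ x in 𝓝 (0 : EuclideanSpace ℂ (Fin m)), x ∈ Metric.eball 0 p.shift.radius :=
    Metric.eball_mem_nhds _ hrad
  filter_upwards [h1, h2] with x hx1 hx2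
  have h3 := hp.hasSum hx1
  have h4 := hq.hasSum hx2
  rw [zero_add] at h3 h4
  have h5 := (ContinuousLinearMap.apply ℂ ℂ x).hasSum h4
  have h6 := (hasSum_nat_add_iff' 1).2 h3
  have h7 : ∀ n, (ContinuousLinearMap.apply ℂ ℂ x) (p.shift n fun _ => x) = p (n + 1) fun _ => x := by
    intro n
    rw [ContinuousLinearMap.apply_apply, FormalMultilinearSeries.shift,
      ContinuousMultilinearMap.curryRight_apply]
    congr 1
    ext i
    refine Fin.lastCases ?_ (fun i => ?_) i <;> simp
  simp only [h7] at h5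
  have h8 := h6.unique h5
  rw [Finset.sum_range_one, hp.coeff_zero] at h8
  rw [sub_eq_iff_eq_add] at h8
  rw [h8, add_comm]
  congr 1
  rw [ContinuousLinearMap.apply_apply]
  change Q x x = ∑ j, x j * Q x (EuclideanSpace.single j (1:ℂ))
  exact clm_sum (Q x) x

theorem pd_hadamard (f : EuclideanSpace ℂ (Fin m) → ℂ)
    (q : Fin m → An (EuclideanSpace ℂ (Fin m))) (c : ℂ)
    (h : ∀ᶠ x in 𝓝 (0 : EuclideanSpace ℂ (Fin m)), f x = c + ∑ j, x j * (q j).1 x) (i : Fin m) :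
    ∀ᶠ x in 𝓝 (0 : EuclideanSpace ℂ (Fin m)),
      pd i f x = (q i).1 x + ∑ j, x j * pd i (q j).1 x := by
  have h1 : ∀ᶠ x in 𝓝 (0 : EuclideanSpace ℂ (Fin m)), ∀ j, AnalyticAt ℂ (q j).1 x := by
    rw [Filter.eventually_all]
    intro j
    exact (q j).2.eventually_analyticAt
  filter_upwards [h.eventually_nhds, h1] with x hx hx1
  have h2 : fderiv ℂ f x = fderiv ℂ (fun x => c + ∑ j, x j * (q j).1 x) x :=
    Filter.EventuallyEq.fderiv_eq hx
  have h3 : ∀ j : Fin m, HasFDerivAt (fun x : EuclideanSpace ℂ (Fin m) => x j * (q j).1 x)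
      (x j • fderiv ℂ (q j).1 x + (q j).1 x • (EuclideanSpace.proj (𝕜 := ℂ) j)) x := fun j =>
    (EuclideanSpace.proj (𝕜 := ℂ) j).hasFDerivAt.mul (hx1 j).differentiableAt.hasFDerivAt
  have h4 := (HasFDerivAt.fun_sum (u := Finset.univ) fun j _ => h3 j).const_add c
  rw [pd, h2, h4.fderiv]
  have h5 : ∀ j : Fin m, (x j • fderiv ℂ (q j).1 x + (q j).1 x • (EuclideanSpace.proj (𝕜 := ℂ) j))
      (EuclideanSpace.single i (1:ℂ)) = x j * pd i (q j).1 x + if j = i then (q j).1 x else 0 := by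
    intro j
    change x j * fderiv ℂ (q j).1 x _ + (q j).1 x * (EuclideanSpace.single i (1:ℂ) : EuclideanSpace ℂ (Fin m)) j = _
    simp [pd]
  rw [sum_apply, Finset.sum_congr rfl fun j _ => h5 j, Finset.sum_add_distrib, add_comm]
  simp

theorem exists_pos_le (s : Fin m → WithTop ℚ) (hs : ∀ i, 0 < s i) :
    ∃ c : ℚ, 0 < c ∧ ∀ i, (c : WithTop ℚ) ≤ s i := by
  have h1 : ∀ i, ∃ c : ℚ, 0 < c ∧ (c : WithTop ℚ) ≤ s i := by
    intro i
    rcases eq_or_ne (s i) ⊤ with h | h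
    · exact ⟨1, one_pos, by rw [h]; exact le_top⟩
    · obtain ⟨q, hq⟩ := WithTop.ne_top_iff_exists.1 h
      refine ⟨q, ?_, hq.le⟩
      have := hs i
      rw [← hq] at this
      exact_mod_cast this
  choose c hc hc1 using h1
  rcases isEmpty_or_nonempty (Fin m) with he | he
  · exact ⟨1, one_pos, fun i => he.elim i⟩
  · obtain ⟨i, hi⟩ := Finite.exists_min c
    exact ⟨c i, hc i, fun j => (WithTop.coe_le_coe.2 (hi j)).trans (hc1 j)⟩

theorem chain_rule (χ : An (EuclideanSpace ℂ (Fin m)) →+* HH)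
    (hgerm : ∀ f g : An (EuclideanSpace ℂ (Fin m)), f.1 =ᶠ[𝓝 0] g.1 → χ f = χ g)
    (hres : ∀ f, Res (χ f) (f.1 0)) (hconst : ∀ c : ℂ, χ (algebraMap ℂ _ c) = CH c)
    (f : An (EuclideanSpace ℂ (Fin m))) :
    DH (χ f) = ∑ j, χ (pdA j f) * DH (χ (coA j)) := by
  let Δ : An (EuclideanSpace ℂ (Fin m)) → HH := fun f => DH (χ f) - ∑ j, χ (pdA j f) * DH (χ (coA j))
  have hrec : ∀ f, ∃ q : Fin m → An (EuclideanSpace ℂ (Fin m)), Δ f = ∑ j, χ (coA j) * Δ (q j) := by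
    intro f
    obtain ⟨q, hq⟩ := hadamard f.1 f.2
    refine ⟨q, ?_⟩
    have h1 : χ f = CH (f.1 0) + ∑ j, χ (coA j) * χ (q j) := by
      rw [← hconst]
      simp only [← map_mul]
      rw [← map_sum, ← map_add]
      apply hgerm
      filter_upwards [hq] with x hx
      rw [hx]
      simp [coA]
    have h2 : ∀ i, χ (pdA i f) = χ (q i) + ∑ j, χ (coA j) * χ (pdA i (q j)) := by
      intro i
      simp only [← map_mul]
      rw [← map_sum, ← map_add]
      apply hgerm
      filter_upwards [pd_hadamard f.1 q _ hq i] with x hx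
      change pd i f.1 x = _
      rw [hx]
      simp [coA, pdA]
    have h3 : DH (χ f) = ∑ j, (χ (coA j) * DH (χ (q j)) + DH (χ (coA j)) * χ (q j)) := by
      rw [h1, map_add, DH_C, zero_add, map_sum]
      exact Finset.sum_congr rfl fun j _ => DH_mul _ _
    change DH (χ f) - _ = _
    rw [h3]
    simp only [h2, Δ]
    simp only [add_mul, mul_sub, Finset.sum_add_distrib, Finset.sum_sub_distrib, Finset.sum_mul, Finset.mul_sum]
    rw [Finset.sum_comm (f := fun x i => χ (coA i) * χ (pdA x (q i)) * DH (χ (coA x)))]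
    have h5 : ∑ j, DH (χ (coA j)) * χ (q j) = ∑ j, χ (q j) * DH (χ (coA j)) :=
      Finset.sum_congr rfl fun j _ => mul_comm _ _
    rw [h5]
    simp only [mul_assoc]
    ring
  have hpos : ∀ f, 0 ≤ vH (Δ f) := by
    intro f
    refine le_trans (le_min ?_ ?_) (vH.map_sub _ _)
    · exact (hres f).deriv.vH_nonneg
    · exact (Res.sum _ _ _ fun j _ => (hres (pdA j f)).mul (hres (coA j)).deriv).vH_nonneg
  obtain ⟨c, hc, hc1⟩ := exists_pos_le (fun j => vH (χ (coA j))) (by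
    intro j
    have := hres (coA j)
    have h0 : (coA j : An (EuclideanSpace ℂ (Fin m))).1 0 = 0 := rfl
    rw [h0, Res, map_zero, sub_zero] at this
    exact this)
  have hk : ∀ k : ℕ, ∀ f, ((k * c : ℚ) : WithTop ℚ) ≤ vH (Δ f) := by
    intro k
    induction k with
    | zero => intro f; simpa using hpos f
    | succ k ih =>
      intro f
      obtain ⟨q, hq⟩ := hrec f
      rw [hq]
      apply AddValuation.map_le_sum
      intro j _
      rw [vH.map_mul]
      have : (((k + 1 : ℕ) * c : ℚ) : WithTop ℚ) = (c : WithTop ℚ) + ((k * c : ℚ) : WithTop ℚ) := by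
        rw [← WithTop.coe_add]
        congr 1
        push_cast
        ring
      rw [this]
      exact add_le_add (hc1 j) (ih _)
  have h0 : Δ f = 0 := by
    by_contra hne
    have h1 : vH (Δ f) ≠ ⊤ := by
      rw [ne_eq, AddValuation.top_iff]; exact hne
    obtain ⟨q, hq⟩ := WithTop.ne_top_iff_exists.1 h1
    obtain ⟨k, hk1⟩ := Archimedean.arch (q + 1) hc
    have := hk k f
    rw [← hq, WithTop.coe_le_coe] at this
    rw [nsmul_eq_mul] at hk1
    linarith
  exact sub_eq_zero.1 h0

end

end Milnor
end

section
open Topology Filter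

set_option linter.style.haveILetI false
namespace Milnor

section
variable {m : ℕ}

/-- parameter space -/
abbrev VV (m : ℕ) : Type := ℂ × EuclideanSpace ℂ (Fin m) × (Fin m → ℂ) × ℂ × ℂ

/-- projections -/
def prL : VV m →L[ℂ] ℂ := ContinuousLinearMap.fst ℂ _ _
/-- projections -/
def prS : VV m →L[ℂ] EuclideanSpace ℂ (Fin m) :=
  (ContinuousLinearMap.fst ℂ _ _).comp (ContinuousLinearMap.snd ℂ _ _)
/-- projections -/
def prW : VV m →L[ℂ] (Fin m → ℂ) :=
  (ContinuousLinearMap.fst ℂ _ _).comp ((ContinuousLinearMap.snd ℂ _ _).comp (ContinuousLinearMap.snd ℂ _ _))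
/-- projections -/
def prE : VV m →L[ℂ] ℂ × ℂ :=
  (ContinuousLinearMap.snd ℂ _ _).comp ((ContinuousLinearMap.snd ℂ _ _).comp (ContinuousLinearMap.snd ℂ _ _))

theorem an_L : AnalyticAt ℂ (fun p : VV m => p.1) 0 := prL.analyticAt 0
theorem an_S (s : EuclideanSpace ℂ (Fin m)) (j : Fin m) : AnalyticAt ℂ (fun p : VV m => s j + p.2.1 j) 0 :=
  analyticAt_const.add (((EuclideanSpace.proj (𝕜 := ℂ) j).comp prS).analyticAt 0)
theorem an_W (c : ℂ) (j : Fin m) : AnalyticAt ℂ (fun p : VV m => c + p.2.2.1 j) 0 :=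
  analyticAt_const.add
    (((ContinuousLinearMap.proj (R := ℂ) (φ := fun _ : Fin m => ℂ) j).comp prW).analyticAt 0)
theorem an_E1 (c : ℂ) : AnalyticAt ℂ (fun p : VV m => c + p.2.2.2.1) 0 :=
  analyticAt_const.add (((ContinuousLinearMap.fst ℂ ℂ ℂ).comp prE).analyticAt 0)
theorem an_E2 (c : ℂ) : AnalyticAt ℂ (fun p : VV m => c + p.2.2.2.2) 0 :=
  analyticAt_const.add (((ContinuousLinearMap.snd ℂ ℂ ℂ).comp prE).analyticAt 0)
theorem an_y (s : EuclideanSpace ℂ (Fin m)) : AnalyticAt ℂ (fun p : VV m => p.1 • (s + p.2.1)) 0 :=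
  (prL.analyticAt 0).smul (analyticAt_const.add (prS.analyticAt 0))

theorem key_alg (g : EuclideanSpace ℂ (Fin m) → ℂ) (hg : AnalyticAt ℂ g 0) (hg0 : g 0 = 0)
    (s0 : EuclideanSpace ℂ (Fin m)) (w0 : Fin m → ℂ) (a1 a2 : ℂ)
    (𝒰 : Ultrafilter (VV m)) (h𝒰 : (𝒰 : Filter (VV m)) ≤ 𝓝 0)
    (hne : ∀ᶠ p in (𝒰 : Filter (VV m)), p.1 ≠ 0 ∧ g (p.1 • (s0 + p.2.1)) ≠ 0)
    (h1 : ∀ᶠ p in (𝒰 : Filter (VV m)), ∀ j, (a1 + p.2.2.2.1) * p.1 * pd j g (p.1 • (s0 + p.2.1)) =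
      (a2 + p.2.2.2.2) * g (p.1 • (s0 + p.2.1)) * (w0 j + p.2.2.1 j))
    (h2 : ∀ᶠ p in (𝒰 : Filter (VV m)), ∑ j, (w0 j + p.2.2.1 j) * (s0 j + p.2.1 j) = 1) :
    ∃ γ η : ℝ, 0 < γ ∧ 0 < η ∧ a1 * γ = a2 * η := by
  have hy0 : (0 : VV m).1 • (s0 + (0 : VV m).2.1) = 0 := by simp
  let Y : An (EuclideanSpace ℂ (Fin m)) →+* An (VV m) :=
    { toFun := fun u => ⟨fun p => u.1 (p.1 • (s0 + p.2.1)), AnalyticAt.fun_comp (g := u.1)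
          (f := fun p : VV m => p.1 • (s0 + p.2.1)) (by rw [hy0]; exact u.2) (an_y s0)⟩
      map_one' := rfl
      map_zero' := rfl
      map_add' := fun _ _ => rfl
      map_mul' := fun _ _ => rfl }
  let gA : An (EuclideanSpace ℂ (Fin m)) := ⟨g, hg⟩
  let L : An (VV m) := ⟨_, an_L⟩
  let S : Fin m → An (VV m) := fun j => ⟨_, an_S s0 j⟩
  let W : Fin m → An (VV m) := fun j => ⟨_, an_W (w0 j) j⟩
  let E1 : An (VV m) := ⟨_, an_E1 a1⟩
  let E2 : An (VV m) := ⟨_, an_E2 a2⟩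
  obtain ⟨φ, hφ, hφh⟩ := arc_aux _ (VV m) rfl 𝒰 h𝒰 (L * Y gA) (by
    rw [mem_PU]
    intro hcon
    obtain ⟨p, hp1, hp2⟩ := (hcon.and hne).exists
    exact mul_ne_zero hp2.1 hp2.2 hp1)
  have hres := hφ.res h𝒰
  rw [map_mul] at hφh
  have hL : φ L ≠ 0 := left_ne_zero_of_mul hφh
  have hG : φ (Y gA) ≠ 0 := right_ne_zero_of_mul hφh
  have hch := chain_rule (φ.comp Y) (by
      intro f f' hff
      rw [RingHom.comp_apply, RingHom.comp_apply, ← sub_eq_zero, ← map_sub]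
      apply hφ.kill
      rw [mem_PU]
      have ht : Tendsto (fun p : VV m => p.1 • (s0 + p.2.1)) (𝓝 0) (𝓝 0) := by
        have := (an_y s0).continuousAt.tendsto
        rwa [hy0] at this
      filter_upwards [h𝒰 (ht.eventually hff)] with p hp
      exact sub_eq_zero.2 hp)
    (fun f => by
      have := hres (Y f)
      have h0 : (Y f).1 0 = f.1 0 := by
        change f.1 ((0 : VV m).1 • (s0 + (0 : VV m).2.1)) = _
        rw [hy0]
      rwa [h0] at this)
    (fun c => hφ.const c) gA
  have hco : ∀ j, Y (coA j) = L * S j := fun j => rfl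
  have e1 : ∀ j, φ E1 * φ L * φ (Y (pdA j gA)) = φ E2 * φ (Y gA) * φ (W j) := by
    intro j
    rw [← map_mul, ← map_mul, ← map_mul, ← map_mul, ← sub_eq_zero, ← map_sub]
    apply hφ.kill
    rw [mem_PU]
    filter_upwards [h1] with p hp
    exact sub_eq_zero.2 (hp j)
  have e2 : ∑ j, φ (W j) * φ (S j) = 1 := by
    rw [← map_one φ, ← sub_eq_zero]
    simp only [← map_mul]
    rw [← map_sum, ← map_sub]
    apply hφ.kill
    rw [mem_PU]
    filter_upwards [h2] with p hp
    have : (∑ j, W j * S j : An (VV m)).1 p = ∑ j, (w0 j + p.2.2.1 j) * (s0 j + p.2.1 j) := by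
      simp [W, S]
    change (∑ j, W j * S j : An (VV m)).1 p - 1 = 0
    rw [this, hp, sub_self]
  have e3 : DH (φ (Y gA)) = ∑ j, φ (Y (pdA j gA)) * (φ L * DH (φ (S j)) + DH (φ L) * φ (S j)) := by
    rw [RingHom.comp_apply] at hch
    rw [hch]
    apply Finset.sum_congr rfl
    intro j _
    rw [RingHom.comp_apply, RingHom.comp_apply, hco, map_mul, DH_mul]
  have e4 : φ E1 * φ L * DH (φ (Y gA)) =
      φ E2 * φ (Y gA) * (φ L * ∑ j, φ (W j) * DH (φ (S j)) + DH (φ L)) := by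
    rw [e3, Finset.mul_sum]
    calc _ = ∑ j, φ E2 * φ (Y gA) * (φ L * (φ (W j) * DH (φ (S j))) + DH (φ L) * (φ (W j) * φ (S j))) := by
          apply Finset.sum_congr rfl
          intro j _
          rw [← mul_assoc, e1]
          ring
      _ = _ := by
          rw [← Finset.mul_sum, Finset.sum_add_distrib, ← Finset.mul_sum, ← Finset.mul_sum, e2, mul_one]
  have e5 : φ E1 * (DH (φ (Y gA)) / φ (Y gA)) =
      φ E2 * (∑ j, φ (W j) * DH (φ (S j)) + DH (φ L) / φ L) := by
    field_simp
    linear_combination e4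
  have r1 : Res (φ E1) a1 := by
    have := hres E1
    have h0 : E1.1 0 = a1 := add_zero a1
    rwa [h0] at this
  have r2 : Res (φ E2) a2 := by
    have := hres E2
    have h0 : E2.1 0 = a2 := add_zero a2
    rwa [h0] at this
  have r3 : Res (∑ j, φ (W j) * DH (φ (S j))) 0 := by
    have := Res.sum Finset.univ (fun j => φ (W j) * DH (φ (S j))) (fun j => (W j).1 0 * 0)
      (fun j _ => (hres (W j)).mul (hres (S j)).deriv)
    simpa using this
  have r4 := r1.mul (Res.logderiv hG)
  have r5 := r2.mul (r3.add (Res.logderiv hL))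
  rw [← e5] at r5
  have r6 := r4.unique r5
  rw [zero_add] at r6
  have hpos : ∀ x : HH, x ≠ 0 → Res x 0 → 0 < x.order := by
    intro x hx hr
    rw [Res, map_zero, sub_zero, HahnSeries.addVal_apply_of_ne hx] at hr
    exact_mod_cast hr
  refine ⟨((φ (Y gA)).order : ℝ), ((φ L).order : ℝ), ?_, ?_, ?_⟩
  · have := hres (Y gA)
    have h0 : (Y gA).1 0 = 0 := by
      change g ((0 : VV m).1 • (s0 + (0 : VV m).2.1)) = _
      rw [hy0, hg0]
    rw [h0] at this
    exact_mod_cast hpos _ hG this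
  · have := hres L
    have h0 : L.1 0 = 0 := rfl
    rw [h0] at this
    exact_mod_cast hpos _ hL this
  · exact_mod_cast r6

end
end Milnor
end

section
open Topology Filter

set_option linter.style.haveILetI false
namespace Milnor

section
variable {m : ℕ}

/-- logarithmic Euler derivative -/
def Eu (g : EuclideanSpace ℂ (Fin m) → ℂ) (z : EuclideanSpace ℂ (Fin m)) : ℂ :=
  (∑ j, z j * pd j g z) / g z

/-- normalising factor -/
def Nf (g : EuclideanSpace ℂ (Fin m) → ℂ) (z : EuclideanSpace ℂ (Fin m)) : ℝ :=
  (Real.sqrt (1 + ‖Eu g z‖ ^ 2))⁻¹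

theorem Nf_pos (g : EuclideanSpace ℂ (Fin m) → ℂ) (z : EuclideanSpace ℂ (Fin m)) : 0 < Nf g z := by
  unfold Nf; positivity

theorem Nf_sq (g : EuclideanSpace ℂ (Fin m) → ℂ) (z : EuclideanSpace ℂ (Fin m)) :
    Nf g z ^ 2 * (1 + ‖Eu g z‖ ^ 2) = 1 := by
  unfold Nf
  rw [inv_pow, Real.sq_sqrt (by positivity), inv_mul_cancel₀ (by positivity)]

/-- coordinates -/
def cz (g : EuclideanSpace ℂ (Fin m) → ℂ) (z : EuclideanSpace ℂ (Fin m)) : VV m :=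
  ((‖z‖ : ℂ), ((‖z‖ : ℂ)⁻¹) • z, fun j => (‖z‖ : ℂ)⁻¹ * (starRingEnd ℂ) (z j), (Nf g z : ℂ), Eu g z * Nf g z)

theorem key_lemma (g : EuclideanSpace ℂ (Fin m) → ℂ) (hg : AnalyticAt ℂ g 0) (hg0 : g 0 = 0) :
    ∃ r > 0, ∀ z : EuclideanSpace ℂ (Fin m), z ≠ 0 → ‖z‖ < r → g z ≠ 0 → ∀ μ : ℂ,
      (∀ j, pd j g z = μ * (starRingEnd ℂ) (z j)) → |(Eu g z).im| < (Eu g z).re := by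
  by_contra hcon
  push Not at hcon
  let Bad : Set (EuclideanSpace ℂ (Fin m)) := {z | z ≠ 0 ∧ g z ≠ 0 ∧
    (∃ μ : ℂ, ∀ j, pd j g z = μ * (starRingEnd ℂ) (z j)) ∧ (Eu g z).re ≤ |(Eu g z).im|}
  have hNB : (𝓝 (0 : EuclideanSpace ℂ (Fin m)) ⊓ 𝓟 Bad).NeBot := by
    rw [neBot_iff, ← mem_closure_iff_nhds_ne_bot, Metric.mem_closure_iff]
    intro r hr
    obtain ⟨z, h1, h2, h3, μ, h4, h5⟩ := hcon r hr
    exact ⟨z, ⟨h1, h3, ⟨μ, h4⟩, h5⟩, by rwa [dist_zero_left]⟩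
  let 𝒲 := Ultrafilter.of (𝓝 (0 : EuclideanSpace ℂ (Fin m)) ⊓ 𝓟 Bad)
  have hW : (𝒲 : Filter (EuclideanSpace ℂ (Fin m))) ≤ 𝓝 0 ⊓ 𝓟 Bad := Ultrafilter.of_le _
  have hW0 : (𝒲 : Filter (EuclideanSpace ℂ (Fin m))) ≤ 𝓝 0 := hW.trans inf_le_left
  have hWB : ∀ᶠ z in (𝒲 : Filter (EuclideanSpace ℂ (Fin m))), z ∈ Bad :=
    hW (mem_inf_of_right (mem_principal_self _))
  have hsmall : ∀ᶠ z in (𝒲 : Filter (EuclideanSpace ℂ (Fin m))), ‖z‖ < 1 := by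
    apply hW0
    have : ∀ᶠ z in 𝓝 (0 : EuclideanSpace ℂ (Fin m)), z ∈ Metric.ball 0 1 := Metric.ball_mem_nhds _ one_pos
    filter_upwards [this] with z hz
    simpa using hz
  have hb : ∀ᶠ z in (𝒲 : Filter (EuclideanSpace ℂ (Fin m))), cz g z ∈ Metric.closedBall (0 : VV m) 1 := by
    filter_upwards [hWB, hsmall] with z hz hz1
    have hz0 : 0 < ‖z‖ := norm_pos_iff.2 hz.1
    have hN := Nf_sq g z
    have hNp := Nf_pos g z
    rw [mem_closedBall_zero_iff, cz, Prod.norm_def, Prod.norm_def, Prod.norm_def, Prod.norm_def]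
    refine max_le ?_ (max_le ?_ (max_le ?_ (max_le ?_ ?_)))
    · simpa using hz1.le
    · simp only [norm_smul, norm_inv, Complex.norm_real, norm_norm]
      rw [inv_mul_cancel₀ hz0.ne']
    · rw [pi_norm_le_iff_of_nonneg zero_le_one]
      intro j
      simp only [norm_mul, norm_inv, Complex.norm_real, norm_norm, RCLike.norm_conj]
      rw [inv_mul_le_iff₀ hz0, mul_one]
      exact PiLp.norm_apply_le z j
    · simp only [Complex.norm_real, Real.norm_eq_abs, abs_of_pos hNp]
      nlinarith [sq_nonneg (Nf g z * ‖Eu g z‖)]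
    · simp only [norm_mul, Complex.norm_real, Real.norm_eq_abs, abs_of_pos hNp]
      nlinarith [norm_nonneg (Eu g z), sq_nonneg (Nf g z)]
  obtain ⟨p0, -, hp0⟩ := (isCompact_closedBall (0 : VV m) 1).ultrafilter_le_nhds (𝒲.map (cz g))
    (by rw [le_principal_iff]; exact hb)
  have hp0' : Tendsto (cz g) 𝒲 (𝓝 p0) := hp0
  -- closed conditions
  have hcl : p0.2.2.2.1.im = 0 ∧ 0 ≤ p0.2.2.2.1.re ∧ ‖p0.2.2.2.1‖ ^ 2 + ‖p0.2.2.2.2‖ ^ 2 = 1 ∧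
      p0.2.2.2.2.re ≤ |p0.2.2.2.2.im| := by
    have hcl : IsClosed {p : VV m | p.2.2.2.1.im = 0 ∧ 0 ≤ p.2.2.2.1.re ∧
        ‖p.2.2.2.1‖ ^ 2 + ‖p.2.2.2.2‖ ^ 2 = 1 ∧ p.2.2.2.2.re ≤ |p.2.2.2.2.im|} := by
      refine IsClosed.and ?_ (IsClosed.and ?_ (IsClosed.and ?_ ?_))
      · exact isClosed_eq (by fun_prop) (by fun_prop)
      · exact isClosed_le (by fun_prop) (by fun_prop)
      · exact isClosed_eq (by fun_prop) (by fun_prop)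
      · exact isClosed_le (by fun_prop) (by fun_prop)
    refine hcl.mem_of_tendsto hp0' ?_
    filter_upwards [hWB] with z hz
    have hNp := Nf_pos g z
    have hN := Nf_sq g z
    refine ⟨Complex.ofReal_im _, hNp.le, ?_, ?_⟩
    · simp only [cz, norm_mul, Complex.norm_real, Real.norm_eq_abs, abs_of_pos hNp]
      linarith
    · simp only [cz, Complex.re_mul_ofReal, Complex.im_mul_ofReal, abs_mul, abs_of_pos hNp]
      exact mul_le_mul_of_nonneg_right hz.2.2.2 hNp.le
  have hl0 : p0.1 = 0 := by
    have h1 : Tendsto (fun z => (cz g z).1) 𝒲 (𝓝 p0.1) := (continuous_fst.tendsto p0).comp hp0'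
    have h2 : Tendsto (fun z => (cz g z).1) 𝒲 (𝓝 0) := by
      have : Continuous (fun z : EuclideanSpace ℂ (Fin m) => (‖z‖ : ℂ)) := by fun_prop
      have := (this.tendsto 0).mono_left hW0
      simpa [cz] using this
    exact tendsto_nhds_unique h1 h2
  let 𝒰 : Ultrafilter (VV m) := 𝒲.map (fun z => cz g z - p0)
  have h𝒰 : (𝒰 : Filter (VV m)) ≤ 𝓝 0 := by
    have := hp0'.sub_const p0
    rw [sub_self] at this
    exact this
  have hval : ∀ z : EuclideanSpace ℂ (Fin m), z ≠ 0 →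
      (cz g z - p0).1 • (p0.2.1 + (cz g z - p0).2.1) = z := by
    intro z hz
    have hz0 : (‖z‖ : ℂ) ≠ 0 := by exact_mod_cast norm_ne_zero_iff.2 hz
    simp only [Prod.fst_sub, Prod.snd_sub, hl0, sub_zero, add_sub_cancel]
    simp only [cz]
    rw [smul_smul, mul_inv_cancel₀ hz0, one_smul]
  obtain ⟨γ, η, hγ, hη, hγη⟩ := key_alg g hg hg0 p0.2.1 p0.2.2.1 p0.2.2.2.1 p0.2.2.2.2 𝒰 h𝒰
    (by
      change ∀ᶠ z in (𝒲 : Filter (EuclideanSpace ℂ (Fin m))), _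
      filter_upwards [hWB] with z hz
      rw [hval z hz.1]
      refine ⟨?_, hz.2.1⟩
      simp only [Prod.fst_sub, hl0, sub_zero]
      simp only [cz]
      exact_mod_cast norm_ne_zero_iff.2 hz.1)
    (by
      change ∀ᶠ z in (𝒲 : Filter (EuclideanSpace ℂ (Fin m))), _
      filter_upwards [hWB] with z hz j
      rw [hval z hz.1]
      obtain ⟨hz1, hz2, ⟨μ, hμ⟩, -⟩ := hz
      have hz0 : (‖z‖ : ℂ) ≠ 0 := by exact_mod_cast norm_ne_zero_iff.2 hz1
      simp only [Prod.fst_sub, Prod.snd_sub, hl0, sub_zero, add_sub_cancel, Pi.sub_apply]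
      simp only [cz]
      have hE : Eu g z * g z = μ * (‖z‖ : ℂ) ^ 2 := by
        rw [Eu, div_mul_cancel₀ _ hz2]
        have h3 : (‖z‖ : ℂ) ^ 2 = ∑ j, z j * (starRingEnd ℂ) (z j) := by
          have := EuclideanSpace.norm_sq_eq z
          rw [← Complex.ofReal_pow, this]
          push_cast
          apply Finset.sum_congr rfl
          intro i _
          rw [Complex.mul_conj']
        rw [h3, Finset.mul_sum]
        apply Finset.sum_congr rfl
        intro i _
        rw [hμ i]
        ring
      rw [hμ j]
      calc _ = (Nf g z : ℂ) * (μ * (‖z‖ : ℂ) ^ 2) * ((‖z‖ : ℂ)⁻¹ * (starRingEnd ℂ) (z j)) := by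
            field_simp
        _ = _ := by rw [← hE]; ring)
    (by
      change ∀ᶠ z in (𝒲 : Filter (EuclideanSpace ℂ (Fin m))), _
      filter_upwards [hWB] with z hz
      have hz0 : (‖z‖ : ℂ) ≠ 0 := by exact_mod_cast norm_ne_zero_iff.2 hz.1
      have h4 : ∀ j, (p0.2.1) j + ((cz g z - p0).2.1) j = (‖z‖ : ℂ)⁻¹ * z j := by
        intro j
        change p0.2.1 j + ((‖z‖ : ℂ)⁻¹ * z j - p0.2.1 j) = _
        ring
      simp only [h4]
      simp only [Prod.fst_sub, Prod.snd_sub, add_sub_cancel, Pi.sub_apply]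
      simp only [cz]
      have h3 : (‖z‖ : ℂ) ^ 2 = ∑ j, z j * (starRingEnd ℂ) (z j) := by
          have := EuclideanSpace.norm_sq_eq z
          rw [← Complex.ofReal_pow, this]
          push_cast
          apply Finset.sum_congr rfl
          intro i _
          rw [Complex.mul_conj']
      calc _ = ((‖z‖ : ℂ)⁻¹) ^ 2 * ∑ j, z j * (starRingEnd ℂ) (z j) := by
            rw [Finset.mul_sum]
            apply Finset.sum_congr rfl
            intro i _
            ring
        _ = 1 := by rw [← h3]; field_simp)
  obtain ⟨c1, c2, c3, c4⟩ := hcl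
  have hre := congrArg Complex.re hγη
  have him := congrArg Complex.im hγη
  simp only [Complex.re_mul_ofReal, Complex.im_mul_ofReal] at hre him
  rw [c1, zero_mul] at him
  have him2 : p0.2.2.2.2.im = 0 := by
    rcases mul_eq_zero.1 him.symm with h | h
    · exact h
    · exact absurd h hη.ne'
  rw [him2, abs_zero] at c4
  have h5 : 0 ≤ p0.2.2.2.1.re * γ := mul_nonneg c2 hγ.le
  have h6 : p0.2.2.2.2.re * η ≤ 0 := mul_nonpos_of_nonpos_of_nonneg c4 hη.le
  have h7 : p0.2.2.2.1.re = 0 := by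
    have : p0.2.2.2.1.re * γ = 0 := le_antisymm (hre ▸ h6) h5
    exact (mul_eq_zero.1 this).resolve_right hγ.ne'
  have h8 : p0.2.2.2.2.re = 0 := by
    have : p0.2.2.2.2.re * η = 0 := by rw [← hre, h7, zero_mul]
    exact (mul_eq_zero.1 this).resolve_right hη.ne'
  have h9 : p0.2.2.2.1 = 0 := Complex.ext h7 c1
  have h10 : p0.2.2.2.2 = 0 := Complex.ext h8 him2
  rw [h9, h10] at c3
  simp at c3

end
end Milnor
end

section
open Topology Filter

set_option linter.style.haveILetI false
namespace Milnor

section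
variable {V : Type*} [NormedAddCommGroup V] [InnerProductSpace ℂ V]

/-- Gram determinant -/
def gA (a z : V) : ℝ := ‖z‖ ^ 2 * ‖a‖ ^ 2 - ‖inner ℂ a z‖ ^ 2

/-- cutoff weight -/
def gB (a z : V) : ℝ := expNegInvGlue ((inner ℂ a z).re - (inner ℂ a z).im) *
  expNegInvGlue ((inner ℂ a z).re + (inner ℂ a z).im)

/-- denominator -/
def gQ (a z : V) : ℝ := gA a z ^ 2 + gB a z * (inner ℂ a z).re

/-- the vector field -/
def gW (a z : V) : V := (Complex.I / (gQ a z : ℂ)) • ((gA a z : ℂ) •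
  (((‖z‖ ^ 2 : ℝ) : ℂ) • a - (inner ℂ z a) • z) + (gB a z : ℂ) • z)

lemma gB_nonneg (a z : V) : 0 ≤ gB a z :=
  mul_nonneg (expNegInvGlue.nonneg _) (expNegInvGlue.nonneg _)

lemma gB_mul (a z : V) : gB a z * |(inner ℂ a z).im| ≤ gB a z * (inner ℂ a z).re := by
  by_cases h : gB a z = 0
  · simp [h]
  · refine mul_le_mul_of_nonneg_left ?_ (gB_nonneg a z)
    have h1 := left_ne_zero_of_mul h
    have h2 := right_ne_zero_of_mul h
    rw [Ne, expNegInvGlue.zero_iff_nonpos] at h1 h2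
    rw [abs_le]
    constructor <;> linarith

lemma gQ_pos {a z : V} (hz : z ≠ 0)
    (h : ∀ μ : ℂ, a = μ • z → |(inner ℂ a z).im| < (inner ℂ a z).re) : 0 < gQ a z := by
  have h1 := gB_mul a z
  have h2 : 0 ≤ gB a z * |(inner ℂ a z).im| := mul_nonneg (gB_nonneg a z) (abs_nonneg _)
  unfold gQ
  by_cases hA : gA a z = 0
  · have : ∃ μ : ℂ, a = μ • z := by
      by_cases ha : a = 0
      · exact ⟨0, by simp [ha]⟩
      · have h3 : ‖inner ℂ z a‖ = ‖z‖ * ‖a‖ := by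
          rw [norm_inner_symm]
          unfold gA at hA
          have : ‖inner ℂ a z‖ ^ 2 = (‖z‖ * ‖a‖) ^ 2 := by rw [mul_pow]; linarith
          exact (sq_eq_sq₀ (norm_nonneg _) (by positivity)).1 this
        rw [norm_inner_eq_norm_iff hz ha] at h3
        obtain ⟨r, _, hr⟩ := h3
        exact ⟨r, hr⟩
    obtain ⟨μ, hμ⟩ := this
    have h3 := h μ hμ
    rw [abs_lt] at h3
    have h4 : 0 < gB a z := mul_pos (expNegInvGlue.pos_of_pos (by linarith))
      (expNegInvGlue.pos_of_pos (by linarith))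
    have : 0 < (inner ℂ a z).re := by linarith
    rw [hA]; positivity
  · have : 0 < gA a z ^ 2 := by positivity
    linarith

lemma inner_gW_left (a z : V) : (inner ℂ z (gW a z)).re = 0 := by
  have h : inner ℂ z (gW a z) = Complex.I * ((gB a z * ‖z‖ ^ 2 / gQ a z : ℝ) : ℂ) := by
    unfold gW
    simp only [inner_smul_right, inner_add_right, inner_sub_right]
    rw [inner_self_eq_norm_sq_to_K]
    push_cast
    simp only [Complex.coe_algebraMap]
    ring
  rw [h, Complex.mul_re, Complex.ofReal_im]; simp

lemma inner_gW (a z : V) : inner ℂ a (gW a z) = Complex.I * ((gA a z ^ 2 : ℝ) +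
    (gB a z : ℂ) * inner ℂ a z) / (gQ a z : ℂ) := by
  have h : inner ℂ z a * inner ℂ a z = ((‖inner ℂ a z‖ ^ 2 : ℝ) : ℂ) := by
    rw [← inner_conj_symm z a, Complex.ofReal_pow]
    exact Complex.conj_mul' _
  have h2 : (gA a z : ℂ) = ((‖z‖ ^ 2 : ℝ) : ℂ) * ((‖a‖ : ℂ) ^ 2) - inner ℂ z a * inner ℂ a z := by
    rw [h]; unfold gA; push_cast; rfl
  unfold gW
  simp only [inner_smul_right, inner_add_right, inner_sub_right]
  rw [inner_self_eq_norm_sq_to_K]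
  simp only [Complex.coe_algebraMap]
  rw [← h2]
  push_cast
  ring

lemma gW_im {a z : V} (hq : 0 < gQ a z) : (inner ℂ a (gW a z)).im = 1 := by
  rw [inner_gW, Complex.div_ofReal_im]
  simp only [Complex.mul_im, Complex.I_re, Complex.I_im, Complex.add_re, Complex.ofReal_re,
    Complex.mul_re, Complex.ofReal_im, zero_mul, one_mul, zero_add, sub_zero]
  exact div_self hq.ne'

lemma gW_re {a z : V} (hq : 0 < gQ a z) : |(inner ℂ a (gW a z)).re| ≤ 1 := by
  rw [inner_gW, Complex.div_ofReal_re]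
  simp only [Complex.mul_re, Complex.I_re, Complex.I_im, Complex.add_im, Complex.ofReal_re,
    Complex.mul_im, Complex.ofReal_im, zero_mul, one_mul, zero_add, zero_sub, add_zero]
  rw [_root_.abs_div, abs_of_pos hq, abs_neg, abs_mul, abs_of_nonneg (gB_nonneg a z), div_le_one hq]
  have := gB_mul a z
  unfold gQ
  nlinarith [sq_nonneg (gA a z)]

lemma gW_contDiffOn {a : V → V} {Ω : Set V} (ha : ContDiffOn ℝ 1 a Ω)
    (hq : ∀ z ∈ Ω, 0 < gQ (a z) z) : ContDiffOn ℝ 1 (fun z => gW (a z) z) Ω := by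
  have hid : ContDiffOn ℝ 1 (fun z : V => z) Ω := contDiffOn_id
  have hE : ContDiffOn ℝ 1 (fun z => inner ℂ (a z) z) Ω := ha.inner ℂ hid
  have hE' : ContDiffOn ℝ 1 (fun z => inner ℂ z (a z)) Ω := hid.inner ℂ ha
  have hn : ContDiffOn ℝ 1 (fun z : V => ‖z‖ ^ 2) Ω := hid.norm_sq ℂ
  have hA : ContDiffOn ℝ 1 (fun z => gA (a z) z) Ω :=
    (hn.mul (ha.norm_sq ℂ)).sub (hE.norm_sq ℂ)
  have hre : ContDiffOn ℝ 1 (fun z => (inner ℂ (a z) z).re) Ω :=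
    Complex.reCLM.contDiff.comp_contDiffOn hE
  have him : ContDiffOn ℝ 1 (fun z => (inner ℂ (a z) z).im) Ω :=
    Complex.imCLM.contDiff.comp_contDiffOn hE
  have hB : ContDiffOn ℝ 1 (fun z => gB (a z) z) Ω :=
    (expNegInvGlue.contDiff.comp_contDiffOn (hre.sub him)).mul
      (expNegInvGlue.contDiff.comp_contDiffOn (hre.add him))
  have hQ : ContDiffOn ℝ 1 (fun z => gQ (a z) z) Ω := (hA.pow 2).add (hB.mul hre)
  have co : ∀ {f : V → ℝ}, ContDiffOn ℝ 1 f Ω → ContDiffOn ℝ 1 (fun z => (f z : ℂ)) Ω :=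
    fun hf => Complex.ofRealCLM.contDiff.comp_contDiffOn hf
  have h1 : ContDiffOn ℝ 1 (fun z => Complex.I / (gQ (a z) z : ℂ)) Ω := by
    have h2 : ContDiffOn ℝ 1 (fun z => Complex.I * (((gQ (a z) z)⁻¹ : ℝ) : ℂ)) Ω :=
      contDiffOn_const.mul (co (hQ.inv fun z hz => (hq z hz).ne'))
    refine h2.congr fun z _ => ?_
    rw [Complex.ofReal_inv, div_eq_mul_inv]
  exact h1.smul (((co hA).smul (((co hn).smul ha).sub (hE'.smul hid))).add ((co hB).smul hid))

theorem exists_field {a : V → V} {Ω : Set V} (ha : ContDiffOn ℝ 1 a Ω)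
    (h0 : ∀ z ∈ Ω, z ≠ 0)
    (h : ∀ z ∈ Ω, ∀ μ : ℂ, a z = μ • z → |(inner ℂ (a z) z).im| < (inner ℂ (a z) z).re) :
    ∃ w : V → V, ContDiffOn ℝ 1 w Ω ∧ ∀ z ∈ Ω, (inner ℂ z (w z)).re = 0 ∧
      (inner ℂ (a z) (w z)).im = 1 ∧ |(inner ℂ (a z) (w z)).re| ≤ 1 := by
  have hq : ∀ z ∈ Ω, 0 < gQ (a z) z := fun z hz => gQ_pos (h0 z hz) (h z hz)
  exact ⟨fun z => gW (a z) z, gW_contDiffOn ha hq, fun z hz => ⟨inner_gW_left _ _,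
    gW_im (hq z hz), gW_re (hq z hz)⟩⟩

end

section
variable {m : ℕ}

/-- the field for `g` -/
theorem exists_field_g (g : EuclideanSpace ℂ (Fin m) → ℂ) {Ω : Set (EuclideanSpace ℂ (Fin m))}
    (hg : ∀ z ∈ Ω, AnalyticAt ℂ g z) (h0 : ∀ z ∈ Ω, z ≠ 0) (hg0 : ∀ z ∈ Ω, g z ≠ 0)
    (key : ∀ z ∈ Ω, ∀ μ : ℂ, (∀ j, pd j g z = μ * (starRingEnd ℂ) (z j)) →
      |(Eu g z).im| < (Eu g z).re) :
    ∃ (w : EuclideanSpace ℂ (Fin m) → EuclideanSpace ℂ (Fin m))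
      (k : EuclideanSpace ℂ (Fin m) → ℂ), ContDiffOn ℝ 1 w Ω ∧
      ∀ z ∈ Ω, (inner ℂ z (w z)).re = 0 ∧ fderiv ℂ g z (w z) = k z * g z ∧ (k z).im = 1 ∧
        |(k z).re| ≤ 1 := by
  set a : EuclideanSpace ℂ (Fin m) → EuclideanSpace ℂ (Fin m) := fun z =>
    WithLp.toLp 2 (fun j => (starRingEnd ℂ) (pd j g z / g z)) with ha
  have hin : ∀ z v, inner ℂ (a z) v = (∑ j, v j * pd j g z) / g z := by
    intro z v
    rw [PiLp.inner_apply, Finset.sum_div]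
    refine Finset.sum_congr rfl fun j _ => ?_
    simp [ha]; ring
  have haC : ContDiffOn ℝ 1 a Ω := by
    rw [contDiffOn_piLp]
    intro j z hz
    have h1 : ContDiffAt ℂ 1 (fun z => pd j g z / g z) z :=
      ((pd_an j (hg z hz)).div (hg z hz) (hg0 z hz)).contDiffAt
    have h2 : ContDiffAt ℝ 1 (fun z => pd j g z / g z) z := h1.restrict_scalars ℝ
    exact (Complex.conjCLE.contDiff.contDiffAt.comp z h2).contDiffWithinAt
  obtain ⟨w, hw, hw2⟩ := exists_field haC h0 (by
    intro z hz μ hμ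
    rw [hin]
    refine key z hz (g z * (starRingEnd ℂ) μ) fun j => ?_
    have h1 := congrArg (fun v : EuclideanSpace ℂ (Fin m) => (starRingEnd ℂ) (v j)) hμ
    simp [ha] at h1
    rw [div_eq_iff (hg0 z hz)] at h1
    rw [h1]; ring)
  refine ⟨w, fun z => inner ℂ (a z) (w z), hw, fun z hz => ⟨(hw2 z hz).1, ?_, (hw2 z hz).2⟩⟩
  change _ = inner ℂ (a z) (w z) * g z
  rw [hin, clm_sum, div_mul_cancel₀ _ (hg0 z hz)]
  rfl

end
end Milnor
end

section
open Topology Filter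

set_option linter.style.haveILetI false
namespace Milnor

section
variable {E : Type*} [NormedAddCommGroup E] [NormedSpace ℝ E]

lemma ode_unique {X : E → E} {K : NNReal} (hL : LipschitzWith K X) {T : ℝ} {γ δ : ℝ → E}
    (hγ : ∀ t, |t| < T → HasDerivAt γ (X (γ t)) t) (hδ : ∀ t, |t| < T → HasDerivAt δ (X (δ t)) t)
    (h0 : γ 0 = δ 0) : ∀ t, |t| < T → γ t = δ t := by
  intro t ht
  have hT : 0 < T := lt_of_le_of_lt (abs_nonneg _) ht
  exact ODE_solution_unique_of_mem_Ioo (v := fun _ => X) (s := fun _ => Set.univ) (K := K)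
    (a := -T) (b := T) (t₀ := 0)
    (fun _ _ => hL.lipschitzOnWith) ⟨by linarith, hT⟩
    (fun t ht => ⟨hγ t (abs_lt.2 ht), trivial⟩) (fun t ht => ⟨hδ t (abs_lt.2 ht), trivial⟩) h0
    (abs_lt.1 ht)

lemma ode_dist_nonneg {X : E → E} {K : NNReal} (hL : LipschitzWith K X) {γ δ : ℝ → E}
    (hγ : ∀ t, HasDerivAt γ (X (γ t)) t) (hδ : ∀ t, HasDerivAt δ (X (δ t)) t) {t : ℝ}
    (ht : 0 ≤ t) : dist (γ t) (δ t) ≤ dist (γ 0) (δ 0) * Real.exp (K * t) := by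
  have := dist_le_of_trajectories_ODE (v := fun _ => X) (K := K) (f := γ) (g := δ) (a := 0) (b := t)
    (fun _ => hL) (HasDerivAt.continuousOn fun s _ => hγ s) (fun s _ => (hγ s).hasDerivWithinAt)
    (HasDerivAt.continuousOn fun s _ => hδ s) (fun s _ => (hδ s).hasDerivWithinAt) le_rfl t
    ⟨ht, le_rfl⟩
  simpa using this

lemma ode_dist {X : E → E} {K : NNReal} (hL : LipschitzWith K X) {γ δ : ℝ → E}
    (hγ : ∀ t, HasDerivAt γ (X (γ t)) t) (hδ : ∀ t, HasDerivAt δ (X (δ t)) t) (t : ℝ) :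
    dist (γ t) (δ t) ≤ dist (γ 0) (δ 0) * Real.exp (K * |t|) := by
  rcases le_total 0 t with ht | ht
  · rw [abs_of_nonneg ht]; exact ode_dist_nonneg hL hγ hδ ht
  · rw [abs_of_nonpos ht]
    have hr : ∀ {γ : ℝ → E}, (∀ t, HasDerivAt γ (X (γ t)) t) →
        ∀ t, HasDerivAt (fun s => γ (-s)) ((fun x => -X x) (γ (-t))) t := by
      intro γ hγ t
      have := (hγ (-t)).scomp t (hasDerivAt_neg t)
      simpa [Function.comp_def] using this
    have hL' : LipschitzWith K (fun x => - X x) := hL.neg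
    have := ode_dist_nonneg (t := -t) hL' (hr hγ) (hr hδ) (by linarith)
    simpa using this

variable [CompleteSpace E]

lemma exists_sol {X : E → E} {K : NNReal} (hL : LipschitzWith K X) {M : ℝ} (hM : ∀ x, ‖X x‖ ≤ M)
    (x : E) (T : ℝ) (hT : 0 < T) :
    ∃ γ : ℝ → E, γ 0 = x ∧ ∀ t, |t| < T → HasDerivAt γ (X (γ t)) t := by
  have hM0 : 0 ≤ M := (norm_nonneg _).trans (hM x)
  have hPL : IsPicardLindelof (fun _ : ℝ => X) (tmin := -T) (tmax := T)
      ⟨0, by linarith, hT.le⟩ x (⟨M * T, by positivity⟩ : NNReal) 0 ⟨M, hM0⟩ K :=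
    IsPicardLindelof.of_time_independent (fun y _ => hM y) hL.lipschitzOnWith (by simp; rfl)
  obtain ⟨γ, h0, h1⟩ := hPL.exists_eq_forall_mem_Icc_hasDerivWithinAt₀
  refine ⟨γ, h0, fun t ht => (h1 t ?_).hasDerivAt ?_⟩
  · exact ⟨(abs_lt.1 ht).1.le, (abs_lt.1 ht).2.le⟩
  · exact Icc_mem_nhds (abs_lt.1 ht).1 (abs_lt.1 ht).2

theorem exists_flow {X : E → E} {K : NNReal} (hL : LipschitzWith K X) {M : ℝ}
    (hM : ∀ x, ‖X x‖ ≤ M) :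
    ∃ Φ : ℝ → E → E, (∀ x, Φ 0 x = x) ∧ (∀ x t, HasDerivAt (fun s => Φ s x) (X (Φ t x)) t) ∧
      Continuous (fun p : ℝ × E => Φ p.1 p.2) ∧ ∀ t x, Φ (-t) (Φ t x) = x := by
  choose γ h0 hd using fun (x : E) (n : ℕ) => exists_sol hL hM x ((n : ℝ) + 1) (by positivity)
  have hcons : ∀ x (n k : ℕ) t, |t| < (n : ℝ) + 1 → |t| < (k : ℝ) + 1 → γ x n t = γ x k t := by
    intro x n k t h1 h2
    refine ode_unique hL (T := min ((n : ℝ) + 1) ((k : ℝ) + 1)) (fun s hs => hd x n s ?_)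
      (fun s hs => hd x k s ?_) (by rw [h0, h0]) t (lt_min h1 h2)
    · exact hs.trans_le (min_le_left _ _)
    · exact hs.trans_le (min_le_right _ _)
  set Φ : ℝ → E → E := fun t x => γ x ⌈|t|⌉₊ t with hΦ
  have hlt : ∀ t : ℝ, |t| < (⌈|t|⌉₊ : ℝ) + 1 := fun t => (Nat.le_ceil _).trans_lt (lt_add_one _)
  have hΦ0 : ∀ x, Φ 0 x = x := fun x => h0 x _
  have hΦd : ∀ x t, HasDerivAt (fun s => Φ s x) (X (Φ t x)) t := by
    intro x t
    have h1 := hd x ⌈|t|⌉₊ t (hlt t)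
    refine h1.congr_of_eventuallyEq ?_
    have : ∀ᶠ s in 𝓝 t, |s| < (⌈|t|⌉₊ : ℝ) + 1 :=
      continuous_abs.continuousAt.eventually_lt continuousAt_const (hlt t)
    filter_upwards [this] with s hs
    exact hcons x _ _ s (hlt s) hs
  refine ⟨Φ, hΦ0, hΦd, ?_, ?_⟩
  · rw [continuous_iff_continuousAt]
    rintro ⟨t₀, x₀⟩
    rw [ContinuousAt, tendsto_iff_dist_tendsto_zero]
    have hb : ∀ p : ℝ × E, dist (Φ p.1 p.2) (Φ t₀ x₀) ≤
        dist p.2 x₀ * Real.exp (K * |p.1|) + dist (Φ p.1 x₀) (Φ t₀ x₀) := by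
      intro p
      refine (dist_triangle _ (Φ p.1 x₀) _).trans (add_le_add ?_ le_rfl)
      have := ode_dist hL (hΦd p.2) (hΦd x₀) p.1
      simpa only [hΦ0] using this
    refine squeeze_zero (fun _ => dist_nonneg) hb ?_
    have hc : ContinuousAt (fun p : ℝ × E => dist p.2 x₀ * Real.exp (K * |p.1|) +
        dist (Φ p.1 x₀) (Φ t₀ x₀)) (t₀, x₀) := by
      refine ContinuousAt.add (by fun_prop) ?_
      refine Tendsto.dist (?_ : ContinuousAt (fun p : ℝ × E => Φ p.1 x₀) (t₀, x₀)) tendsto_const_nhds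
      exact ContinuousAt.comp (f := Prod.fst) (g := fun s => Φ s x₀)
        (hΦd x₀ t₀).continuousAt continuousAt_fst
    have := hc.tendsto
    simpa using this
  · intro t x
    have h1 : ∀ s, HasDerivAt (fun s => Φ (s + t) x) (X (Φ (s + t) x)) s := by
      intro s
      have := (hΦd x (s + t)).scomp s ((hasDerivAt_id s).add_const t)
      simpa [Function.comp_def] using this
    have := ode_unique hL (T := |-t| + 1) (γ := fun s => Φ s (Φ t x)) (δ := fun s => Φ (s + t) x)
      (fun s _ => hΦd _ s) (fun s _ => h1 s) (by simp [hΦ0]) (-t) (lt_add_one _)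
    simpa [hΦ0] using this

end
end Milnor
end

section
open Topology Filter

set_option linter.style.haveILetI false
namespace Milnor

section
variable {E : Type*} [NormedAddCommGroup E] [NormedSpace ℝ E] [FiniteDimensional ℝ E]

open scoped Manifold in
theorem exists_cutoff_field {Ω C : Set E} (hΩ : IsOpen Ω) (hC : IsCompact C) (hCΩ : C ⊆ Ω)
    {w : E → E} (hw : ContDiffOn ℝ 1 w Ω) :
    ∃ (X : E → E) (χ : E → ℝ) (K : NNReal) (M : ℝ), LipschitzWith K X ∧ (∀ x, ‖X x‖ ≤ M) ∧
      (∀ x, X x = χ x • w x) ∧ (∀ x, x ∉ Ω → χ x = 0) ∧ (∀ x, 0 ≤ χ x ∧ χ x ≤ 1) ∧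
      ∀ x ∈ C, χ x = 1 := by
  obtain ⟨L, hL, hCL, hLΩ⟩ := exists_compact_between hC hΩ hCΩ
  obtain ⟨f, hf1, hf0, hf⟩ := exists_contMDiffMap_one_nhds_of_subset_interior 𝓘(ℝ, E) (n := 1)
    hC.isClosed hCL
  have hfc : ContDiff ℝ 1 (f : E → ℝ) := f.contMDiff.contDiff
  have hcont : ContDiff ℝ 1 (fun x => f x • w x) := by
    rw [contDiff_iff_contDiffAt]
    intro x
    by_cases hx : x ∈ Ω
    · exact hfc.contDiffAt.smul (hw.contDiffAt (hΩ.mem_nhds hx))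
    · have : (fun x => f x • w x) =ᶠ[𝓝 x] fun _ => 0 := by
        filter_upwards [hL.isClosed.isOpen_compl.mem_nhds (fun h => hx (hLΩ h))] with y hy
        rw [hf0 y hy, zero_smul]
      exact contDiffAt_const.congr_of_eventuallyEq this
  have hsupp : HasCompactSupport (fun x => f x • w x) :=
    HasCompactSupport.intro hL fun x hx => by rw [hf0 x hx, zero_smul]
  obtain ⟨K, hK⟩ := hcont.lipschitzWith_of_hasCompactSupport hsupp one_ne_zero
  obtain ⟨M, hM⟩ := hsupp.exists_bound_of_continuous hcont.continuous
  exact ⟨_, f, K, M, hK, hM, fun x => rfl, fun x hx => hf0 x fun h => hx (hLΩ h),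
    fun x => ⟨(hf x).1, (hf x).2⟩, fun x hx => hf1.self_of_nhdsSet x hx⟩

end

section
variable {V : Type*} [NormedAddCommGroup V] [InnerProductSpace ℂ V]

lemma norm_const {γ γ' : ℝ → V} (hd : ∀ t, HasDerivAt γ (γ' t) t)
    (h : ∀ t, (inner ℂ (γ t) (γ' t)).re = 0) (t : ℝ) : ‖γ t‖ = ‖γ 0‖ := by
  have h1 : ∀ t, HasDerivAt (fun t => inner ℂ (γ t) (γ t)) 0 t := by
    intro t
    have h2 := (hd t).inner ℂ (hd t)
    have h3 : inner ℂ (γ t) (γ' t) + inner ℂ (γ' t) (γ t) = 0 := by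
      rw [← inner_conj_symm (γ' t) (γ t), Complex.add_conj, h t]
      simp
    rwa [h3] at h2
  have h2 := is_const_of_deriv_eq_zero (fun t => (h1 t).differentiableAt)
    (fun t => (h1 t).deriv) t 0
  simp only [inner_self_eq_norm_sq_to_K] at h2
  have h3 : ‖γ t‖ ^ 2 = ‖γ 0‖ ^ 2 := by exact_mod_cast h2
  exact (sq_eq_sq₀ (norm_nonneg _) (norm_nonneg _)).1 h3

end

lemma inner_mul_self (k f : ℂ) : inner ℝ f (k * f) = k.re * ‖f‖ ^ 2 := by
  rw [Complex.inner, ← Complex.normSq_eq_norm_sq, Complex.normSq_apply]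
  simp; ring

lemma growth_nonneg {f k : ℝ → ℂ} (hf : ∀ t, HasDerivAt f (k t * f t) t)
    (hk : ∀ t, |(k t).re| ≤ 1) {t : ℝ} (ht : 0 ≤ t) : Real.exp (-t) * ‖f 0‖ ≤ ‖f t‖ := by
  have h1 : ∀ t, HasDerivAt (fun t => Real.exp (2 * t) * ‖f t‖ ^ 2)
      (Real.exp (2 * t) * (2 * (1 + (k t).re) * ‖f t‖ ^ 2)) t := by
    intro t
    have h2 := (hf t).norm_sq
    rw [inner_mul_self] at h2
    have h3 : HasDerivAt (fun t : ℝ => Real.exp (2 * t)) (Real.exp (2 * t) * (2 * 1)) t :=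
      ((hasDerivAt_id t).const_mul 2).exp
    refine (h3.mul h2).congr_deriv ?_
    ring
  have hm : Monotone (fun t => Real.exp (2 * t) * ‖f t‖ ^ 2) := by
    refine monotone_of_deriv_nonneg (fun t => (h1 t).differentiableAt) fun t => ?_
    rw [(h1 t).deriv]
    have := (abs_le.1 (hk t)).1
    have : 0 ≤ 1 + (k t).re := by linarith
    positivity
  have h2 := hm ht
  simp only [mul_zero, Real.exp_zero, one_mul] at h2
  rw [← pow_le_pow_iff_left₀ (by positivity) (norm_nonneg _) two_ne_zero, mul_pow,
    ← Real.exp_nat_mul]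
  have h3 : Real.exp (((2 : ℕ) : ℝ) * -t) * Real.exp (2 * t) = 1 := by
    rw [← Real.exp_add]; simp
  calc _ ≤ Real.exp (((2 : ℕ) : ℝ) * -t) * (Real.exp (2 * t) * ‖f t‖ ^ 2) := by gcongr
    _ = _ := by rw [← mul_assoc, h3, one_mul]

lemma growth {f k : ℝ → ℂ} (hf : ∀ t, HasDerivAt f (k t * f t) t)
    (hk : ∀ t, |(k t).re| ≤ 1) (t : ℝ) : Real.exp (-|t|) * ‖f 0‖ ≤ ‖f t‖ := by
  rcases le_total 0 t with ht | ht
  · rw [abs_of_nonneg ht]; exact growth_nonneg hf hk ht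
  · rw [abs_of_nonpos ht]
    have h1 : ∀ t, HasDerivAt (fun s => f (-s)) ((fun s => - k (-s)) t * (fun s => f (-s)) t) t := by
      intro t
      have := (hf (-t)).scomp t (hasDerivAt_neg t)
      simpa [Function.comp_def] using this
    have := growth_nonneg h1 (fun t => by simpa using hk (-t)) (t := -t) (by linarith)
    simpa using this

lemma phase {f k : ℝ → ℂ} {T : ℝ} (hf : ∀ t, |t| < T → HasDerivAt f (k t * f t) t)
    (hne : ∀ t, |t| < T → f t ≠ 0) (hk : ∀ t, |t| < T → (k t).im = 1) {t : ℝ} (ht : |t| < T) :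
    f t / (‖f t‖ : ℂ) = Complex.exp (t * Complex.I) * (f 0 / (‖f 0‖ : ℂ)) := by
  have hN : ∀ t, |t| < T → HasDerivAt (fun t => ‖f t‖) ((k t).re * ‖f t‖) t := by
    intro t ht
    have h2 := (hf t ht).norm_sq
    rw [inner_mul_self] at h2
    have h0 : ‖f t‖ ≠ 0 := norm_ne_zero_iff.2 (hne t ht)
    have h3 := h2.sqrt (pow_ne_zero 2 h0)
    simp only [Real.sqrt_sq (norm_nonneg _)] at h3
    convert h3 using 1
    field_simp
  have hu : ∀ t, |t| < T → HasDerivAt (fun t : ℝ => Complex.exp (-(t * Complex.I)) *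
      (f t / (‖f t‖ : ℂ))) 0 t := by
    intro t ht
    have h0 : (‖f t‖ : ℂ) ≠ 0 := Complex.ofReal_ne_zero.2 (norm_ne_zero_iff.2 (hne t ht))
    have h1 := (hf t ht).div (hN t ht).ofReal_comp h0
    have h2 : HasDerivAt (fun t : ℝ => Complex.exp (-(t * Complex.I)))
        (Complex.exp (-(t * Complex.I)) * -(1 * Complex.I)) t :=
      (((hasDerivAt_id t).ofReal_comp.mul_const Complex.I).neg).cexp
    have h3 := h2.mul h1
    refine h3.congr_deriv ?_
    have hkt : k t = ((k t).re : ℂ) + Complex.I := by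
      apply Complex.ext <;> simp [hk t ht]
    rw [Pi.div_apply, hkt]
    simp only [Complex.add_re, Complex.ofReal_re, Complex.I_re, add_zero, Complex.ofReal_mul]
    field_simp
    ring
  have hT : 0 < T := (abs_nonneg _).trans_lt ht
  have hc := isOpen_Ioo.is_const_of_deriv_eq_zero (isPreconnected_Ioo (a := -T) (b := T))
    (fun s hs => (hu s (abs_lt.2 hs)).differentiableAt.differentiableWithinAt)
    (fun s hs => (hu s (abs_lt.2 hs)).deriv) (abs_lt.1 ht) (show (0 : ℝ) ∈ Set.Ioo (-T) T from
      ⟨by linarith, hT⟩)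
  simp only [Complex.ofReal_zero, zero_mul, neg_zero, Complex.exp_zero, one_mul] at hc
  rw [← hc, ← mul_assoc, ← Complex.exp_add]
  simp

end Milnor
end

section
open Topology Filter

set_option linter.style.haveILetI false
namespace Milnor

section
variable {V : Type*} [NormedAddCommGroup V] [InnerProductSpace ℂ V] [FiniteDimensional ℝ V]

theorem flow_c {g : V → ℂ} {r ε : ℝ} (_hε : 0 < ε) (hεr : ε < r)
    (hg : ∀ z, ‖z‖ < r → DifferentiableAt ℂ g z) {w : V → V} {k : V → ℂ} {Ω : Set V}
    (hΩo : IsOpen Ω) (hΩ : ∀ z, ‖z‖ = ε → g z ≠ 0 → z ∈ Ω)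
    (hw : ContDiffOn ℝ 1 w Ω)
    (hwk : ∀ z ∈ Ω, (inner ℂ z (w z)).re = 0 ∧ fderiv ℂ g z (w z) = k z * g z ∧ (k z).im = 1 ∧
        |(k z).re| ≤ 1) (c : ℝ) (hc : 0 < c) :
    ∃ (Φ : ℝ → V → V) (X : V → V) (K : NNReal), LipschitzWith K X ∧ (∀ x, Φ 0 x = x) ∧
      (∀ x t, HasDerivAt (fun s => Φ s x) (X (Φ t x)) t) ∧
      Continuous (fun p : ℝ × V => Φ p.1 p.2) ∧ (∀ t x, Φ (-t) (Φ t x) = x) ∧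
      (∀ z, ‖z‖ = ε → c ≤ ‖g z‖ → X z = w z) ∧
      (∀ x t, ‖x‖ = ε → ‖Φ t x‖ = ε ∧ Real.exp (-|t|) * ‖g x‖ ≤ ‖g (Φ t x)‖) ∧
      ∀ x t T, ‖x‖ = ε → |t| < T → c * Real.exp T ≤ ‖g x‖ →
        g (Φ t x) / (‖g (Φ t x)‖ : ℂ) = Complex.exp (t * Complex.I) * (g x / (‖g x‖ : ℂ)) := by
  have : ProperSpace V := FiniteDimensional.proper ℝ V
  have : CompleteSpace V := inferInstance
  set C : Set V := {z | ‖z‖ = ε ∧ c ≤ ‖g z‖} with hCdef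
  have hC : IsCompact C := by
    have h1 : C = Metric.sphere 0 ε ∩ (fun z => ‖g z‖) ⁻¹' Set.Ici c := by
      ext z; simp [hCdef]
    refine (isCompact_sphere (0 : V) ε).of_isClosed_subset ?_ (h1 ▸ Set.inter_subset_left)
    rw [h1]
    refine ContinuousOn.preimage_isClosed_of_isClosed ?_ Metric.isClosed_sphere isClosed_Ici
    intro z hz
    have hz' : ‖z‖ = ε := by simpa using hz
    exact (hg z (by rw [hz']; exact hεr)).continuousAt.norm.continuousWithinAt
  have hCΩ : C ⊆ Ω := fun z hz => hΩ z hz.1 (norm_pos_iff.1 (hc.trans_le hz.2))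
  obtain ⟨X, χ, K, M, hK, hM, hX, hχ0, hχ, hχ1⟩ := exists_cutoff_field hΩo hC hCΩ hw
  obtain ⟨Φ, hΦ0, hΦd, hΦc, hΦi⟩ := exists_flow hK hM
  have htan : ∀ z, (inner ℂ z (X z)).re = 0 := by
    intro z
    by_cases hz : z ∈ Ω
    · rw [hX, show χ z • w z = (χ z : ℂ) • w z from (Complex.coe_smul _ _).symm, inner_smul_right,
        Complex.re_ofReal_mul, (hwk z hz).1, mul_zero]
    · rw [hX, hχ0 z hz]; simp
  have hder : ∀ z, fderiv ℂ g z (X z) = ((χ z : ℂ) * k z) * g z := by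
    intro z
    by_cases hz : z ∈ Ω
    · rw [hX, show χ z • w z = (χ z : ℂ) • w z from (Complex.coe_smul _ _).symm, map_smul,
        (hwk z hz).2.1, smul_eq_mul, mul_assoc]
    · rw [hX, hχ0 z hz]; simp
  have hre : ∀ z, |((χ z : ℂ) * k z).re| ≤ 1 := by
    intro z
    by_cases hz : z ∈ Ω
    · rw [Complex.re_ofReal_mul, abs_mul, abs_of_nonneg (hχ z).1]
      exact mul_le_one₀ (hχ z).2 (abs_nonneg _) (hwk z hz).2.2.2
    · rw [hχ0 z hz]; simp
  have hnorm : ∀ x t, ‖x‖ = ε → ‖Φ t x‖ = ε := by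
    intro x t hx
    rw [norm_const (hΦd x) (fun t => htan _) t, hΦ0, hx]
  have hgd : ∀ x, ‖x‖ = ε → ∀ t, HasDerivAt (fun s => g (Φ s x))
      ((fun t => (χ (Φ t x) : ℂ) * k (Φ t x)) t * (fun s => g (Φ s x)) t) t := by
    intro x hx t
    have h1 := (hg (Φ t x) (by rw [hnorm x t hx]; exact hεr)).hasFDerivAt.restrictScalars ℝ
    have h2 := h1.comp_hasDerivAt t (hΦd x t)
    refine h2.congr_deriv ?_
    exact hder _
  have hgrow : ∀ x t, ‖x‖ = ε → Real.exp (-|t|) * ‖g x‖ ≤ ‖g (Φ t x)‖ := by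
    intro x t hx
    have := growth (hgd x hx) (fun t => hre _) t
    simpa only [hΦ0] using this
  have hX1 : ∀ z, ‖z‖ = ε → c ≤ ‖g z‖ → χ z = 1 := fun z h1 h2 => hχ1 z ⟨h1, h2⟩
  refine ⟨Φ, X, K, hK, hΦ0, hΦd, hΦc, hΦi, fun z h1 h2 => by rw [hX, hX1 z h1 h2, one_smul],
    fun x t hx => ⟨hnorm x t hx, hgrow x t hx⟩, fun x t T hx ht hcx => ?_⟩
  have hlow : ∀ s, |s| < T → c ≤ ‖g (Φ s x)‖ := by
    intro s hs
    refine le_trans ?_ (hgrow x s hx)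
    calc c = Real.exp (-T) * (c * Real.exp T) := by
          rw [mul_left_comm, ← Real.exp_add]; simp
      _ ≤ Real.exp (-|s|) * ‖g x‖ := by gcongr
  have := phase (f := fun s => g (Φ s x)) (fun t _ => hgd x hx t)
    (fun s hs => norm_pos_iff.1 (hc.trans_le (hlow s hs)))
    (fun s hs => by
      change ((χ (Φ s x) : ℂ) * k (Φ s x)).im = 1
      rw [hX1 _ (hnorm x s hx) (hlow s hs), Complex.ofReal_one, one_mul]
      exact (hwk _ (hCΩ ⟨hnorm x s hx, hlow s hs⟩)).2.2.1) ht
  simpa only [hΦ0] using this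

theorem flow_M {g : V → ℂ} {r ε : ℝ} (_hε : 0 < ε) (hεr : ε < r)
    (hg : ∀ z, ‖z‖ < r → DifferentiableAt ℂ g z) {w : V → V} {k : V → ℂ} {Ω : Set V}
    (hΩo : IsOpen Ω) (hΩ : ∀ z, ‖z‖ = ε → g z ≠ 0 → z ∈ Ω)
    (hw : ContDiffOn ℝ 1 w Ω)
    (hwk : ∀ z ∈ Ω, (inner ℂ z (w z)).re = 0 ∧ fderiv ℂ g z (w z) = k z * g z ∧ (k z).im = 1 ∧
        |(k z).re| ≤ 1) (T : ℝ) :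
    ∃ Φ : ℝ → V → V,
      ContinuousOn (fun p : ℝ × V => Φ p.1 p.2) {p | |p.1| < T ∧ ‖p.2‖ = ε ∧ g p.2 ≠ 0} ∧
      ∀ x t, |t| < T → ‖x‖ = ε → g x ≠ 0 → ‖Φ t x‖ = ε ∧ g (Φ t x) ≠ 0 ∧
        g (Φ t x) / (‖g (Φ t x)‖ : ℂ) = Complex.exp (t * Complex.I) * (g x / (‖g x‖ : ℂ)) ∧
        Φ (-t) (Φ t x) = x := by
  have H : ∀ c : ℝ, ∃ (Φ : ℝ → V → V) (X : V → V) (K : NNReal), 0 < c →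
      LipschitzWith K X ∧ (∀ x, Φ 0 x = x) ∧
      (∀ x t, HasDerivAt (fun s => Φ s x) (X (Φ t x)) t) ∧
      Continuous (fun p : ℝ × V => Φ p.1 p.2) ∧ (∀ t x, Φ (-t) (Φ t x) = x) ∧
      (∀ z, ‖z‖ = ε → c ≤ ‖g z‖ → X z = w z) ∧
      (∀ x t, ‖x‖ = ε → ‖Φ t x‖ = ε ∧ Real.exp (-|t|) * ‖g x‖ ≤ ‖g (Φ t x)‖) ∧
      ∀ x t T, ‖x‖ = ε → |t| < T → c * Real.exp T ≤ ‖g x‖ →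
        g (Φ t x) / (‖g (Φ t x)‖ : ℂ) = Complex.exp (t * Complex.I) * (g x / (‖g x‖ : ℂ)) := by
    intro c
    by_cases hc : 0 < c
    · obtain ⟨Φ, X, K, h⟩ := flow_c _hε hεr hg hΩo hΩ hw hwk c hc
      exact ⟨Φ, X, K, fun _ => h⟩
    · exact ⟨fun _ => id, id, 0, fun h => (hc h).elim⟩
  choose F X K hF using H
  have hexp : Real.exp (-T) * Real.exp T = 1 := by rw [← Real.exp_add]; simp
  -- consistency
  have hcons : ∀ c c' x t, 0 < c' → c' ≤ c → ‖x‖ = ε → c * Real.exp T ≤ ‖g x‖ → |t| < T →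
      F c t x = F c' t x := by
    intro c c' x t hc' hcc hx hcx ht
    obtain ⟨hK, h0, hd, -, -, hXw, hn, -⟩ := hF c (hc'.trans_le hcc)
    obtain ⟨hK', h0', hd', -, -, hXw', hn', -⟩ := hF c' hc'
    refine ode_unique hK' (T := T) (γ := fun s => F c s x) (δ := fun s => F c' s x)
      (fun s hs => ?_) (fun s _ => hd' x s) ?_ t ht
    · have h1 : c ≤ ‖g (F c s x)‖ := by
        refine le_trans ?_ (hn x s hx).2
        calc c = Real.exp (-T) * (c * Real.exp T) := by
              rw [mul_left_comm, hexp, mul_one]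
          _ ≤ Real.exp (-|s|) * ‖g x‖ := by
              have : 0 < c := hc'.trans_le hcc
              gcongr
      have h2 := hd x s
      rw [hXw _ (hn x s hx).1 h1, ← hXw' _ (hn x s hx).1 (hcc.trans h1)] at h2
      exact h2
    · change F c 0 x = F c' 0 x
      rw [h0, h0']
  set cc : V → ℝ := fun x => ‖g x‖ * Real.exp (-T) with hcc
  have hccpos : ∀ x, g x ≠ 0 → 0 < cc x := fun x hx =>
    mul_pos (norm_pos_iff.2 hx) (Real.exp_pos _)
  have hccle : ∀ x, cc x * Real.exp T ≤ ‖g x‖ := fun x => by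
    rw [hcc]; simp only; rw [mul_assoc, hexp, mul_one]
  have hcons' : ∀ x t c', 0 < c' → c' ≤ cc x → ‖x‖ = ε → |t| < T → F (cc x) t x = F c' t x :=
    fun x t c' h1 h2 h3 h4 => hcons (cc x) c' x t h1 h2 h3 (hccle x) h4
  refine ⟨fun t x => F (cc x) t x, ?_, ?_⟩
  · rintro ⟨t₀, x₀⟩ ⟨ht₀, hx₀, hgx₀⟩
    simp only at ht₀ hx₀ hgx₀
    set c₀ := cc x₀ / 2 with hc₀
    have hc₀pos : 0 < c₀ := half_pos (hccpos x₀ hgx₀)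
    have hcca : ContinuousAt cc x₀ :=
      ((hg x₀ (by rw [hx₀]; exact hεr)).continuousAt.norm).mul continuousAt_const
    have hev : ∀ᶠ x in 𝓝 x₀, c₀ < cc x :=
      continuousAt_const.eventually_lt hcca (half_lt_self (hccpos x₀ hgx₀))
    have hev2 : ∀ᶠ p : ℝ × V in 𝓝 (t₀, x₀), c₀ < cc p.2 :=
      (continuousAt_snd (p := (t₀, x₀))).eventually hev
    have hcF : ContinuousAt (fun p : ℝ × V => F c₀ p.1 p.2) (t₀, x₀) :=
      (hF c₀ hc₀pos).2.2.2.1.continuousAt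
    refine hcF.continuousWithinAt.congr_of_eventuallyEq ?_ ?_
    · filter_upwards [mem_nhdsWithin_of_mem_nhds hev2, self_mem_nhdsWithin] with p hp hp2
      exact hcons' p.2 p.1 c₀ hc₀pos hp.le hp2.2.1 hp2.1
    · exact hcons' x₀ t₀ c₀ hc₀pos (half_le_self (hccpos x₀ hgx₀).le) hx₀ ht₀
  · intro x t ht hx hgx
    obtain ⟨hK, h0, hd, -, hi, hXw, hn, hp⟩ := hF (cc x) (hccpos x hgx)
    have hne : g (F (cc x) t x) ≠ 0 := by
      have := (hn x t hx).2
      refine norm_pos_iff.1 (lt_of_lt_of_le ?_ this)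
      exact mul_pos (Real.exp_pos _) (norm_pos_iff.2 hgx)
    refine ⟨(hn x t hx).1, hne, hp x t T hx ht (hccle x), ?_⟩
    have hn1 := (hn x t hx).1
    have hn2 := (hn x t hx).2
    change F (cc (F (cc x) t x)) (-t) (F (cc x) t x) = x
    generalize hy : F (cc x) t x = y at *
    set c₁ := Real.exp (-|t|) * cc x with hc₁
    have hc₁pos : 0 < c₁ := mul_pos (Real.exp_pos _) (hccpos x hgx)
    rw [hcons' y (-t) c₁ hc₁pos ?_ hn1 (by rwa [abs_neg]), ← hy,
      hcons' x t c₁ hc₁pos ?_ hx ht]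
    · exact (hF c₁ hc₁pos).2.2.2.2.1 t x
    · rw [hc₁]
      exact mul_le_of_le_one_left (hccpos x hgx).le (Real.exp_le_one_iff.2 (by simp))
    · rw [hc₁, hcc]
      simp only
      rw [← mul_assoc]
      gcongr

end
end Milnor
end

section
namespace Milnor

lemma exists_angle (y : sphere (0 : ℂ) 1) : ∃ (W : Set (sphere (0 : ℂ) 1)) (θ : sphere (0 : ℂ) 1 → ℝ),
    IsOpen W ∧ y ∈ W ∧ ContinuousOn θ W ∧ (∀ z, |θ z| < 7) ∧
    ∀ z, Complex.exp (θ z * Complex.I) = z := by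
  have hn : ∀ z : sphere (0 : ℂ) 1, ‖(z : ℂ)‖ = 1 := fun z => by simpa using z.2
  have hexp : ∀ z : ℂ, ‖z‖ = 1 → Complex.exp (Complex.arg z * Complex.I) = z := by
    intro z hz
    have := Complex.norm_mul_exp_arg_mul_I z
    rwa [hz, Complex.ofReal_one, one_mul] at this
  have hc : Continuous (fun z : sphere (0 : ℂ) 1 => (z : ℂ) * (starRingEnd ℂ) (y : ℂ)) :=
    continuous_subtype_val.mul continuous_const
  refine ⟨(fun z : sphere (0 : ℂ) 1 => (z : ℂ) * (starRingEnd ℂ) (y : ℂ)) ⁻¹' Complex.slitPlane,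
    fun z => Complex.arg y + Complex.arg ((z : ℂ) * (starRingEnd ℂ) (y : ℂ)),
    Complex.isOpen_slitPlane.preimage hc, ?_, ?_, ?_, ?_⟩
  · change (y : ℂ) * (starRingEnd ℂ) (y : ℂ) ∈ Complex.slitPlane
    rw [Complex.mul_conj', hn]
    simp
  · refine continuousOn_const.add fun z hz => ?_
    exact ((Complex.continuousAt_arg hz).comp (f := fun z : sphere (0 : ℂ) 1 =>
      (z : ℂ) * (starRingEnd ℂ) (y : ℂ)) hc.continuousAt).continuousWithinAt
  · intro z
    have h1 := Complex.abs_arg_le_pi (y : ℂ)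
    have h2 := Complex.abs_arg_le_pi ((z : ℂ) * (starRingEnd ℂ) (y : ℂ))
    have := abs_add_le (Complex.arg y) (Complex.arg ((z : ℂ) * (starRingEnd ℂ) (y : ℂ)))
    have := Real.pi_lt_d2
    linarith
  · intro z
    push_cast
    rw [add_mul, Complex.exp_add, hexp _ (hn y), hexp _ (by simp [hn])]
    rw [mul_left_comm, Complex.mul_conj', hn]
    simp

theorem locTriv_of_flow {X : Type} [TopologicalSpace X] (q : X → sphere (0 : ℂ) 1)
    (hq : Continuous q) (Ψ : ℝ → X → X)
    (hc : ContinuousOn (fun p : ℝ × X => Ψ p.1 p.2) {p | |p.1| < 7})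
    (hph : ∀ t x, |t| < 7 → (q (Ψ t x) : ℂ) = Complex.exp (t * Complex.I) * q x)
    (hinv : ∀ t x, |t| < 7 → Ψ (-t) (Ψ t x) = x) : IsLocTrivialFibration q := by
  refine ⟨{x : X // (q x : ℂ) = 1}, inferInstance, fun y => ?_⟩
  obtain ⟨W, θ, hW, hyW, hθc, hθ, hθe⟩ := exists_angle y
  have h1 : ∀ x : X, (q (Ψ (-θ (q x)) x) : ℂ) = 1 := by
    intro x
    rw [hph _ _ (by rw [abs_neg]; exact hθ _)]
    conv_lhs => rw [← hθe (q x)]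
    rw [← Complex.exp_add]
    simp [hθe]
  have h2 : ∀ (z : sphere (0 : ℂ) 1) (x : {x : X // (q x : ℂ) = 1}), q (Ψ (θ z) x.1) = z := by
    intro z x
    apply Subtype.ext
    rw [hph _ _ (hθ z), x.2, mul_one, hθe]
  refine ⟨W, hW, hyW,
    { toFun := fun x => (⟨q x.1, x.2⟩, ⟨Ψ (-θ (q x.1)) x.1, h1 x.1⟩)
      invFun := fun p => ⟨Ψ (θ p.1.1) p.2.1, by
        change q _ ∈ W
        rw [h2]; exact p.1.2⟩
      left_inv := ?_
      right_inv := ?_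
      continuous_toFun := ?_
      continuous_invFun := ?_ }, fun x => rfl⟩
  · intro x
    apply Subtype.ext
    have := hinv (-θ (q x.1)) x.1 (by rw [abs_neg]; exact hθ _)
    rw [neg_neg] at this
    exact this
  · rintro ⟨z, x⟩
    refine Prod.ext (Subtype.ext (h2 z.1 x)) (Subtype.ext ?_)
    change Ψ (-θ (q (Ψ (θ z.1) x.1))) (Ψ (θ z.1) x.1) = x.1
    rw [h2]
    exact hinv _ _ (hθ _)
  · have hθ' : Continuous (fun x : q ⁻¹' W => θ (q x.1)) :=
      hθc.comp_continuous (hq.comp continuous_subtype_val) (fun x => x.2)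
    refine Continuous.prodMk ?_ ?_
    · exact (hq.comp continuous_subtype_val).subtype_mk _
    · refine Continuous.subtype_mk ?_ _
      exact hc.comp_continuous (f := fun x : q ⁻¹' W => (-θ (q x.1), x.1))
        (hθ'.neg.prodMk continuous_subtype_val) (fun x => by
          change |-θ (q x.1)| < 7
          rw [abs_neg]; exact hθ _)
  · refine Continuous.subtype_mk ?_ _
    have hθ' : Continuous (fun p : W × {x : X // (q x : ℂ) = 1} => θ p.1.1) :=
      hθc.comp_continuous (continuous_subtype_val.comp continuous_fst) (fun p => p.1.2)
    exact hc.comp_continuous (f := fun p : W × {x : X // (q x : ℂ) = 1} => (θ p.1.1, p.2.1))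
        (hθ'.prodMk (continuous_subtype_val.comp continuous_snd)) (fun x => hθ _)

end Milnor
end

/-- Milnor's fibration theorem for holomorphic functions: for `g : ℂ^{n+1} → ℂ` complex-analytic
on a neighborhood of `0`, non-constant, with `g 0 = 0`, there is `ε₀ > 0` such that for all
`0 < ε ≤ ε₀` the map `z ↦ g z / ‖g z‖`, from `S_ε^{2n+1} \ K_ε` (where
`K_ε = g⁻¹(0) ∩ S_ε^{2n+1}`) to the unit circle in `ℂ`, is a locally trivial fibration. -/
theorem milnor_fibration_sphere_complex (n : ℕ) (hn : 1 ≤ n)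
    (g : EuclideanSpace ℂ (Fin (n + 1)) → ℂ)
    (U : Set (EuclideanSpace ℂ (Fin (n + 1)))) (hU : IsOpen U)
    (h0U : (0 : EuclideanSpace ℂ (Fin (n + 1))) ∈ U)
    (hg : AnalyticOnNhd ℂ g U)
    (hgnc : ∃ x ∈ U, g x ≠ g 0)
    (hg0 : g 0 = 0) :
    ∃ ε₀ > 0, ∀ ε, 0 < ε → ε ≤ ε₀ →
      IsLocTrivialFibration
        (fun z : ↥(sphere (0 : EuclideanSpace ℂ (Fin (n + 1))) ε \
            (g ⁻¹' {0} ∩ sphere (0 : EuclideanSpace ℂ (Fin (n + 1))) ε)) =>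
          (⟨g z.1 / (‖g z.1‖ : ℂ), by
            have hz : g z.1 ≠ 0 := fun h => z.2.2 ⟨h, z.2.1⟩
            simp only [mem_sphere_iff_norm, sub_zero, norm_div, Complex.norm_real,
              Real.norm_eq_abs, abs_norm]
            exact div_self (norm_ne_zero_iff.mpr hz)⟩ : ↥(sphere (0 : ℂ) 1))) := by
  obtain ⟨r₁, hr₁, hkey⟩ := Milnor.key_lemma g (hg 0 h0U) hg0
  obtain ⟨r₂, hr₂, hball⟩ := Metric.isOpen_iff.1 hU 0 h0U
  have hrpos : 0 < min r₁ r₂ := lt_min hr₁ hr₂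
  have hgr : ∀ z : EuclideanSpace ℂ (Fin (n + 1)), ‖z‖ < min r₁ r₂ → AnalyticAt ℂ g z :=
    fun z hz => hg z (hball (by simpa using hz.trans_le (min_le_right _ _)))
  set Ω : Set (EuclideanSpace ℂ (Fin (n + 1))) :=
    {z | z ≠ 0 ∧ ‖z‖ < min r₁ r₂ ∧ g z ≠ 0} with hΩdef
  have hΩo : IsOpen Ω := by
    rw [isOpen_iff_mem_nhds]
    rintro z ⟨h1, h2, h3⟩
    filter_upwards [isOpen_ne.mem_nhds h1,
      continuous_norm.continuousAt.eventually_lt continuousAt_const h2,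
      (hgr z h2).continuousAt.eventually_ne h3] with x hx1 hx2 hx3
    exact ⟨hx1, hx2, hx3⟩
  obtain ⟨w, k, hw, hwk⟩ := Milnor.exists_field_g g (Ω := Ω) (fun z hz => hgr z hz.2.1)
    (fun z hz => hz.1) (fun z hz => hz.2.2)
    (fun z hz μ hμ => hkey z hz.1 (hz.2.1.trans_le (min_le_left _ _)) hz.2.2 μ hμ)
  refine ⟨min r₁ r₂ / 2, half_pos hrpos, fun ε hε hε₀ => ?_⟩
  have hεr : ε < min r₁ r₂ := hε₀.trans_lt (half_lt_self hrpos)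
  obtain ⟨Φ, hΦc, hΦ⟩ := Milnor.flow_M hε hεr (fun z hz => (hgr z hz).differentiableAt) hΩo
    (fun z hz hgz => ⟨norm_pos_iff.1 (hz ▸ hε), hz ▸ hεr, hgz⟩) hw hwk 7
  have hM : ∀ z : ↥(sphere (0 : EuclideanSpace ℂ (Fin (n + 1))) ε \
      (g ⁻¹' {0} ∩ sphere (0 : EuclideanSpace ℂ (Fin (n + 1))) ε)), ‖z.1‖ = ε ∧ g z.1 ≠ 0 :=
    fun z => ⟨by simpa using z.2.1, fun h => z.2.2 ⟨h, z.2.1⟩⟩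
  have hM' : ∀ z : EuclideanSpace ℂ (Fin (n + 1)), ‖z‖ = ε → g z ≠ 0 →
      z ∈ sphere (0 : EuclideanSpace ℂ (Fin (n + 1))) ε \
      (g ⁻¹' {0} ∩ sphere (0 : EuclideanSpace ℂ (Fin (n + 1))) ε) :=
    fun z h1 h2 => ⟨by simpa using h1, fun h => h2 h.1⟩
  have hcg : Continuous (fun z : ↥(sphere (0 : EuclideanSpace ℂ (Fin (n + 1))) ε \
      (g ⁻¹' {0} ∩ sphere (0 : EuclideanSpace ℂ (Fin (n + 1))) ε)) => g z.1) := by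
    rw [continuous_iff_continuousAt]
    intro z
    have h1 : ContinuousAt g z.1 := (hgr z.1 (by rw [(hM z).1]; exact hεr)).continuousAt
    exact ContinuousAt.comp (f := Subtype.val) h1 continuousAt_subtype_val
  classical
  refine Milnor.locTriv_of_flow _ ?_
    (fun t z => if ht : |t| < 7 then ⟨Φ t z.1, hM' _ (hΦ z.1 t ht (hM z).1 (hM z).2).1
      (hΦ z.1 t ht (hM z).1 (hM z).2).2.1⟩ else z) ?_ ?_ ?_
  · refine Continuous.subtype_mk ?_ _
    refine hcg.div (Complex.continuous_ofReal.comp hcg.norm) fun z => ?_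
    exact Complex.ofReal_ne_zero.2 (norm_ne_zero_iff.2 (hM z).2)
  · rw [Topology.IsInducing.subtypeVal.continuousOn_iff]
    have h1 : ContinuousOn (fun p : ℝ × ↥(sphere (0 : EuclideanSpace ℂ (Fin (n + 1))) ε \
        (g ⁻¹' {0} ∩ sphere (0 : EuclideanSpace ℂ (Fin (n + 1))) ε)) => Φ p.1 p.2.1)
        {p | |p.1| < 7} := by
      refine ContinuousOn.comp (t := {p : ℝ × EuclideanSpace ℂ (Fin (n + 1)) |
        |p.1| < 7 ∧ ‖p.2‖ = ε ∧ g p.2 ≠ 0}) (f := fun p : ℝ × ↥(sphere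
        (0 : EuclideanSpace ℂ (Fin (n + 1))) ε \ (g ⁻¹' {0} ∩
        sphere (0 : EuclideanSpace ℂ (Fin (n + 1))) ε)) => (p.1, p.2.1)) hΦc ?_ ?_
      · exact (continuous_fst.prodMk (continuous_subtype_val.comp continuous_snd)).continuousOn
      · intro p hp
        exact ⟨hp, hM p.2⟩
    refine h1.congr fun p hp => ?_
    have hp' : |p.1| < 7 := hp
    simp only [Function.comp_def, dif_pos hp']
  · intro t z ht
    simp only [dif_pos ht]
    exact (hΦ z.1 t ht (hM z).1 (hM z).2).2.2.1
  · intro t z ht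
    have ht' : |-t| < 7 := by rwa [abs_neg]
    simp only [dif_pos ht, dif_pos ht']
    exact Subtype.ext (hΦ z.1 t ht (hM z).1 (hM z).2).2.2.2
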